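/- arXiv:2101.10720 — 2 statements merged into one kernel-verified Lean document; each statement's English description precedes it below -/
import Mathlib

section
/- Every ν-calculus term of a name-free type is contextually equivalent to a pure simply-typed λ-calculus term (containing no names and no gensym). In particular, for α built only from Unit, Bool, products and arrows, and any ν-calculus term M of type α, there exists a term N with no name constants and no occurrence of gensym such that M and N are contextually equivalent. -/
/-! Types of the ν-calculus: Unit, Bool, the name type Nm, products and arrows. -/
inductive Ty : Type
  | unit : Ty
  | bool : Ty
  | nm : Ty
  | prod : Ty → Ty → Ty
  | arrow : Ty → Ty → Ty
  deriving DecidableEq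

/-! Terms of the ν-calculus, with named variables (names and variables are ℕ). -/
inductive Tm : Type
  | var : ℕ → Tm
  | unit : Tm
  | tt : Tm
  | ff : Tm
  | name : ℕ → Tm
  | gensym : Tm
  | lam : ℕ → Ty → Tm → Tm
  | app : Tm → Tm → Tm
  | pair : Tm → Tm → Tm
  | fst : Tm → Tm
  | snd : Tm → Tm
  | cond : Tm → Tm → Tm → Tm
  | letin : ℕ → Tm → Tm → Tm
  | eq : Tm → Tm → Tm
  deriving DecidableEq

/-- The finite set of name constants occurring in a term. -/
def AN : Tm → Finset ℕ
  | .name r => {r}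
  | .lam _ _ M => AN M
  | .app M N => AN M ∪ AN N
  | .pair M N => AN M ∪ AN N
  | .fst M => AN M
  | .snd M => AN M
  | .cond M N₁ N₂ => AN M ∪ AN N₁ ∪ AN N₂
  | .letin _ M N => AN M ∪ AN N
  | .eq M N => AN M ∪ AN N
  | _ => ∅

/-- Free variables of a term. -/
def FV : Tm → Finset ℕ
  | .var x => {x}
  | .lam x _ M => FV M \ {x}
  | .app M N => FV M ∪ FV N
  | .pair M N => FV M ∪ FV N
  | .fst M => FV M
  | .snd M => FV M
  | .cond M N₁ N₂ => FV M ∪ FV N₁ ∪ FV N₂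
  | .letin x M N => FV M ∪ (FV N \ {x})
  | .eq M N => FV M ∪ FV N
  | _ => ∅

/-- Substitution of a closed term `V` for the variable `x` (no capture since `V` is closed). -/
def subst (x : ℕ) (V : Tm) : Tm → Tm
  | .var y => if y = x then V else .var y
  | .lam y α M => if y = x then .lam y α M else .lam y α (subst x V M)
  | .app M N => .app (subst x V M) (subst x V N)
  | .pair M N => .pair (subst x V M) (subst x V N)
  | .fst M => .fst (subst x V M)
  | .snd M => .snd (subst x V M)
  | .cond M N₁ N₂ => .cond (subst x V M) (subst x V N₁) (subst x V N₂)
  | .letin y M N => .letin y (subst x V M) (if y = x then N else subst x V N)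
  | .eq M N => .eq (subst x V M) (subst x V N)
  | t => t

/-- Values. -/
inductive IsValue : Tm → Prop
  | var : ∀ x, IsValue (.var x)
  | unit : IsValue .unit
  | tt : IsValue .tt
  | ff : IsValue .ff
  | name : ∀ r, IsValue (.name r)
  | gensym : IsValue .gensym
  | lam : ∀ x α M, IsValue (.lam x α M)
  | pair : ∀ {V W}, IsValue V → IsValue W → IsValue (.pair V W)

/-- Typing contexts: ordered lists of variable/type pairs, later entries more recent. -/
abbrev Ctx := List (ℕ × Ty)

/-- Look up the most recent binding of `x` in `Γ`. -/
def lookupVar (Γ : Ctx) (x : ℕ) : Option Ty :=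
  (Γ.reverse.find? (fun p => p.1 == x)).map Prod.snd

/-- Typing judgement `Γ ⊢ M : α` of the ν-calculus. -/
inductive Typed : Ctx → Tm → Ty → Prop
  | var : ∀ {Γ x α}, lookupVar Γ x = some α → Typed Γ (.var x) α
  | unit : ∀ {Γ}, Typed Γ .unit .unit
  | tt : ∀ {Γ}, Typed Γ .tt .bool
  | ff : ∀ {Γ}, Typed Γ .ff .bool
  | name : ∀ {Γ} (r : ℕ), Typed Γ (.name r) .nm
  | gensym : ∀ {Γ}, Typed Γ .gensym (.arrow .unit .nm)
  | lam : ∀ {Γ x α β M}, Typed (Γ ++ [(x, α)]) M β → Typed Γ (.lam x α M) (.arrow α β)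
  | app : ∀ {Γ M N α β}, Typed Γ M (.arrow α β) → Typed Γ N α → Typed Γ (.app M N) β
  | pair : ∀ {Γ M N α β}, Typed Γ M α → Typed Γ N β → Typed Γ (.pair M N) (.prod α β)
  | fst : ∀ {Γ M α β}, Typed Γ M (.prod α β) → Typed Γ (.fst M) α
  | snd : ∀ {Γ M α β}, Typed Γ M (.prod α β) → Typed Γ (.snd M) β
  | cond : ∀ {Γ M N₁ N₂ α}, Typed Γ M .bool → Typed Γ N₁ α → Typed Γ N₂ α →
      Typed Γ (.cond M N₁ N₂) α
  | letin : ∀ {Γ x M N α β}, Typed Γ M α → Typed (Γ ++ [(x, α)]) N β →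
      Typed Γ (.letin x M N) β
  | eqNm : ∀ {Γ M N}, Typed Γ M .nm → Typed Γ N .nm → Typed Γ (.eq M N) .bool
  | eqBool : ∀ {Γ M N}, Typed Γ M .bool → Typed Γ N .bool → Typed Γ (.eq M N) .bool

/-- Big-step call-by-value evaluation on configurations `(G, M) ⇓ (G', V)` where `G`
is the set of names generated so far. -/
inductive Eval : Finset ℕ → Tm → Finset ℕ → Tm → Prop
  | val : ∀ {G V}, IsValue V → Eval G V G V
  | app : ∀ {G G₁ G₂ G₃ M N B V W x α},
      Eval G M G₁ (.lam x α B) → Eval G₁ N G₂ W → IsValue W →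
      Eval G₂ (subst x W B) G₃ V → Eval G (.app M N) G₃ V
  | gensym : ∀ {G G₁ G₂ M N} (r : ℕ),
      Eval G M G₁ .gensym → Eval G₁ N G₂ .unit → r ∉ G₂ →
      Eval G (.app M N) (insert r G₂) (.name r)
  | pair : ∀ {G G₁ G₂ M N V W},
      Eval G M G₁ V → Eval G₁ N G₂ W → Eval G (.pair M N) G₂ (.pair V W)
  | fst : ∀ {G G₁ M V W}, Eval G M G₁ (.pair V W) → Eval G (.fst M) G₁ V
  | snd : ∀ {G G₁ M V W}, Eval G M G₁ (.pair V W) → Eval G (.snd M) G₁ W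
  | condT : ∀ {G G₁ G₂ M N₁ N₂ V},
      Eval G M G₁ .tt → Eval G₁ N₁ G₂ V → Eval G (.cond M N₁ N₂) G₂ V
  | condF : ∀ {G G₁ G₂ M N₁ N₂ V},
      Eval G M G₁ .ff → Eval G₁ N₂ G₂ V → Eval G (.cond M N₁ N₂) G₂ V
  | letin : ∀ {G G₁ G₂ M N W V x},
      Eval G M G₁ W → IsValue W → Eval G₁ (subst x W N) G₂ V →
      Eval G (.letin x M N) G₂ V
  | eqT : ∀ {G G₁ G₂ M N r},
      Eval G M G₁ (.name r) → Eval G₁ N G₂ (.name r) → Eval G (.eq M N) G₂ .tt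
  | eqF : ∀ {G G₁ G₂ M N r s},
      Eval G M G₁ (.name r) → Eval G₁ N G₂ (.name s) → r ≠ s →
      Eval G (.eq M N) G₂ .ff
  | eqBoolT : ∀ {G G₁ G₂ M N b},
      Eval G M G₁ b → Eval G₁ N G₂ b → (b = Tm.tt ∨ b = Tm.ff) →
      Eval G (.eq M N) G₂ .tt
  | eqBoolF : ∀ {G G₁ G₂ M N b₁ b₂},
      Eval G M G₁ b₁ → Eval G₁ N G₂ b₂ →
      ((b₁ = Tm.tt ∧ b₂ = Tm.ff) ∨ (b₁ = Tm.ff ∧ b₂ = Tm.tt)) →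
      Eval G (.eq M N) G₂ .ff

/-- Types not mentioning the name type `Nm`. -/
def NmFreeTy : Ty → Prop
  | .nm => False
  | .prod a b => NmFreeTy a ∧ NmFreeTy b
  | .arrow a b => NmFreeTy a ∧ NmFreeTy b
  | _ => True

/-- Base types β ::= Unit | Bool | β × β. -/
inductive BaseTy : Ty → Prop
  | unit : BaseTy .unit
  | bool : BaseTy .bool
  | prod : ∀ {a b}, BaseTy a → BaseTy b → BaseTy (.prod a b)

/-- Terms with no occurrence of `gensym`. -/
def NoGensym : Tm → Prop
  | .gensym => False
  | .lam _ _ M => NoGensym M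
  | .app M N => NoGensym M ∧ NoGensym N
  | .pair M N => NoGensym M ∧ NoGensym N
  | .fst M => NoGensym M
  | .snd M => NoGensym M
  | .cond M N₁ N₂ => NoGensym M ∧ NoGensym N₁ ∧ NoGensym N₂
  | .letin _ M N => NoGensym M ∧ NoGensym N
  | .eq M N => NoGensym M ∧ NoGensym N
  | _ => True

/-- Logical expressions: variables, constants, pairing and projections. -/
def IsExpr : Tm → Prop
  | .var _ => True
  | .unit => True
  | .tt => True
  | .ff => True
  | .pair e e' => IsExpr e ∧ IsExpr e'
  | .fst e => IsExpr e
  | .snd e => IsExpr e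
  | _ => False

def boolVal : Bool → Tm
  | true => .tt
  | false => .ff

/-- Contextual equivalence of closed terms `M, N` of type `α` with names in `G`:
every boolean-valued closing context (a term with one free variable, the hole)
with names in `G` evaluates `M` and `N` to the same boolean. -/
def CtxEquiv (G : Finset ℕ) (α : Ty) (M N : Tm) : Prop :=
  ∀ (h : ℕ) (C : Tm) (b : Bool), Typed [(h, α)] C .bool → AN C ⊆ G →
    ((∃ G', Eval G (subst h M C) G' (boolVal b)) ↔
     (∃ G', Eval G (subst h N C) G' (boolVal b)))

/-- Models: finite maps from variables to closed values, as ordered lists. -/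
abbrev Model := List (ℕ × Tm)

/-- All names occurring in a model. -/
def ANModel (ξ : Model) : Finset ℕ := ξ.foldr (fun p s => AN p.2 ∪ s) ∅

/-- Closure of a term by a model: substitute each binding. -/
def msubst (ξ : Model) (M : Tm) : Tm := ξ.foldl (fun N p => subst p.1 p.2 N) M

/-- Look up the value of `x` in the model `ξ`. -/
def modelLookup (ξ : Model) (x : ℕ) : Option Tm :=
  (ξ.reverse.find? (fun p => p.1 == x)).map Prod.snd

/-- A model is typed by a context when it binds the same variables, in order,
to closed values of the corresponding types. -/
inductive ModelTyped : Ctx → Model → Prop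
  | nil : ModelTyped [] []
  | cons : ∀ {Γ ξ x α V}, IsValue V → Typed [] V α → ModelTyped Γ ξ →
      ModelTyped ((x, α) :: Γ) ((x, V) :: ξ)

/-- Single-step model extension: add one binding `y : V` where `V` is derived
from the current model by a name-free term. -/
def ModelExt1 (p q : Ctx × Model) : Prop :=
  ∃ (y : ℕ) (α : Ty) (M V : Tm) (G' : Finset ℕ),
    q.1 = p.1 ++ [(y, α)] ∧ q.2 = p.2 ++ [(y, V)] ∧
    AN M = ∅ ∧ Typed p.1 M α ∧ IsValue V ∧
    Eval (ANModel p.2) (msubst p.2 M) G' V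

/-- Model extension `ξ ⪯* ξ′`: reflexive-transitive closure of single steps. -/
def ModelExt : Ctx × Model → Ctx × Model → Prop := Relation.ReflTransGen ModelExt1

namespace NuCalculus

/-! ### Evaluation -/

theorem Eval.isValue {G G' : Finset ℕ} {M V : Tm} (h : Eval G M G' V) : IsValue V := by
  induction h with
  | val h => exact h
  | app _ _ _ _ _ _ ih => exact ih
  | gensym r => exact .name r
  | pair _ _ ih₁ ih₂ => exact .pair ih₁ ih₂
  | fst _ ih => cases ih with | pair h _ => exact h
  | snd _ ih => cases ih with | pair _ h => exact h
  | condT _ _ _ ih => exact ih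
  | condF _ _ _ ih => exact ih
  | letin _ _ _ _ ih => exact ih
  | eqT => exact .tt
  | eqF => exact .ff
  | eqBoolT => exact .tt
  | eqBoolF => exact .ff

theorem eval_value_eq {V : Tm} (hV : IsValue V) :
    ∀ {G G' U}, Eval G V G' U → G' = G ∧ U = V := by
  induction hV with
  | pair _ _ ih₁ ih₂ =>
    intro G G' U h
    cases h with
    | val => exact ⟨rfl, rfl⟩
    | pair h₁ h₂ =>
      obtain ⟨rfl, rfl⟩ := ih₁ h₁
      obtain ⟨rfl, rfl⟩ := ih₂ h₂
      exact ⟨rfl, rfl⟩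
  | _ => intro G G' U h; cases h; exact ⟨rfl, rfl⟩

theorem eval_value_iff {V : Tm} (hV : IsValue V) {G G' : Finset ℕ} {U : Tm} :
    Eval G V G' U ↔ G' = G ∧ U = V :=
  ⟨eval_value_eq hV, by rintro ⟨rfl, rfl⟩; exact .val hV⟩

/-- `K` is an evaluation frame: evaluating `K P` first evaluates `P`. -/
def IsFrame (K : Tm → Tm) : Prop :=
  ∀ P G G'' U, Eval G (K P) G'' U ↔ ∃ G' V, Eval G P G' V ∧ Eval G' (K V) G'' U

theorem isFrame_appL (N : Tm) : IsFrame (Tm.app · N) := by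
  intro P G G'' U
  constructor
  · intro h
    cases h with
    | val h => cases h
    | app h₁ h₂ h₃ h₄ => exact ⟨_, _, h₁, .app (.val (.lam _ _ _)) h₂ h₃ h₄⟩
    | gensym r h₁ h₂ h₃ => exact ⟨_, _, h₁, .gensym r (.val .gensym) h₂ h₃⟩
  · rintro ⟨G', V, hP, h⟩
    cases h with
    | val h => cases h
    | app h₁ h₂ h₃ h₄ =>
      obtain ⟨rfl, rfl⟩ := eval_value_eq (Eval.isValue hP) h₁
      exact .app hP h₂ h₃ h₄
    | gensym r h₁ h₂ h₃ =>
      obtain ⟨rfl, rfl⟩ := eval_value_eq (Eval.isValue hP) h₁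
      exact .gensym r hP h₂ h₃

theorem isFrame_appR {F : Tm} (hF : IsValue F) : IsFrame (Tm.app F) := by
  intro P G G'' U
  constructor
  · intro h
    cases h with
    | val h => cases h
    | app h₁ h₂ h₃ h₄ =>
      obtain ⟨rfl, rfl⟩ := eval_value_eq hF h₁
      exact ⟨_, _, h₂, .app (.val hF) (.val h₃) h₃ h₄⟩
    | gensym r h₁ h₂ h₃ =>
      obtain ⟨rfl, rfl⟩ := eval_value_eq hF h₁
      exact ⟨_, _, h₂, .gensym r (.val hF) (.val .unit) h₃⟩
  · rintro ⟨G', V, hP, h⟩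
    cases h with
    | val h => cases h
    | app h₁ h₂ h₃ h₄ =>
      obtain ⟨rfl, rfl⟩ := eval_value_eq hF h₁
      obtain ⟨rfl, rfl⟩ := eval_value_eq (Eval.isValue hP) h₂
      exact .app (.val hF) hP h₃ h₄
    | gensym r h₁ h₂ h₃ =>
      obtain ⟨rfl, rfl⟩ := eval_value_eq hF h₁
      obtain ⟨rfl, rfl⟩ := eval_value_eq (Eval.isValue hP) h₂
      exact .gensym r (.val hF) hP h₃

theorem eval_pair_iff {M N U : Tm} {G G'' : Finset ℕ} :
    Eval G (.pair M N) G'' U ↔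
      ∃ G' V W, Eval G M G' V ∧ Eval G' N G'' W ∧ U = .pair V W := by
  constructor
  · intro h
    cases h with
    | val h => cases h with | pair h₁ h₂ => exact ⟨_, _, _, .val h₁, .val h₂, rfl⟩
    | pair h₁ h₂ => exact ⟨_, _, _, h₁, h₂, rfl⟩
  · rintro ⟨G', V, W, h₁, h₂, rfl⟩
    exact .pair h₁ h₂

theorem isFrame_pairL (N : Tm) : IsFrame (Tm.pair · N) := by
  intro P G G'' U
  simp only [eval_pair_iff]
  constructor
  · rintro ⟨G', V, W, h₁, h₂, rfl⟩
    exact ⟨_, _, h₁, _, _, _, .val (Eval.isValue h₁), h₂, rfl⟩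
  · rintro ⟨G', V, hP, _, _, W, h₁, h₂, rfl⟩
    obtain ⟨rfl, rfl⟩ := eval_value_eq (Eval.isValue hP) h₁
    exact ⟨_, _, _, hP, h₂, rfl⟩

theorem isFrame_pairR {V : Tm} (hV : IsValue V) : IsFrame (Tm.pair V) := by
  intro P G G'' U
  simp only [eval_pair_iff]
  constructor
  · rintro ⟨G', V, W, h₁, h₂, rfl⟩
    obtain ⟨rfl, rfl⟩ := eval_value_eq hV h₁
    exact ⟨_, _, h₂, _, _, _, .val hV, .val (Eval.isValue h₂), rfl⟩
  · rintro ⟨G', W, hP, _, _, _, h₁, h₂, rfl⟩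
    obtain ⟨rfl, rfl⟩ := eval_value_eq hV h₁
    obtain ⟨rfl, rfl⟩ := eval_value_eq (Eval.isValue hP) h₂
    exact ⟨_, _, _, .val hV, hP, rfl⟩

theorem isFrame_fst : IsFrame Tm.fst := by
  intro P G G'' U
  constructor
  · intro h
    cases h with
    | val h => cases h
    | fst h => exact ⟨_, _, h, .fst (.val (Eval.isValue h))⟩
  · rintro ⟨G', V, hP, h⟩
    cases h with
    | val h => cases h
    | fst h =>
      obtain ⟨rfl, rfl⟩ := eval_value_eq (Eval.isValue hP) h
      exact .fst hP

theorem isFrame_snd : IsFrame Tm.snd := by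
  intro P G G'' U
  constructor
  · intro h
    cases h with
    | val h => cases h
    | snd h => exact ⟨_, _, h, .snd (.val (Eval.isValue h))⟩
  · rintro ⟨G', V, hP, h⟩
    cases h with
    | val h => cases h
    | snd h =>
      obtain ⟨rfl, rfl⟩ := eval_value_eq (Eval.isValue hP) h
      exact .snd hP

theorem isFrame_cond (N₁ N₂ : Tm) : IsFrame (Tm.cond · N₁ N₂) := by
  intro P G G'' U
  constructor
  · intro h
    cases h with
    | val h => cases h
    | condT h₁ h₂ => exact ⟨_, _, h₁, .condT (.val .tt) h₂⟩
    | condF h₁ h₂ => exact ⟨_, _, h₁, .condF (.val .ff) h₂⟩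
  · rintro ⟨G', V, hP, h⟩
    cases h with
    | val h => cases h
    | condT h₁ h₂ =>
      obtain ⟨rfl, rfl⟩ := eval_value_eq (Eval.isValue hP) h₁
      exact .condT hP h₂
    | condF h₁ h₂ =>
      obtain ⟨rfl, rfl⟩ := eval_value_eq (Eval.isValue hP) h₁
      exact .condF hP h₂

theorem isFrame_letin (x : ℕ) (N : Tm) : IsFrame (Tm.letin x · N) := by
  intro P G G'' U
  constructor
  · intro h
    cases h with
    | val h => cases h
    | letin h₁ h₂ h₃ => exact ⟨_, _, h₁, .letin (.val h₂) h₂ h₃⟩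
  · rintro ⟨G', V, hP, h⟩
    cases h with
    | val h => cases h
    | letin h₁ h₂ h₃ =>
      obtain ⟨rfl, rfl⟩ := eval_value_eq (Eval.isValue hP) h₁
      exact .letin hP h₂ h₃

theorem isFrame_eqL (N : Tm) : IsFrame (Tm.eq · N) := by
  intro P G G'' U
  constructor
  · intro h
    cases h with
    | val h => cases h
    | eqT h₁ h₂ => exact ⟨_, _, h₁, .eqT (.val (Eval.isValue h₁)) h₂⟩
    | eqF h₁ h₂ h₃ => exact ⟨_, _, h₁, .eqF (.val (Eval.isValue h₁)) h₂ h₃⟩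
    | eqBoolT h₁ h₂ h₃ => exact ⟨_, _, h₁, .eqBoolT (.val (Eval.isValue h₁)) h₂ h₃⟩
    | eqBoolF h₁ h₂ h₃ => exact ⟨_, _, h₁, .eqBoolF (.val (Eval.isValue h₁)) h₂ h₃⟩
  · rintro ⟨G', V, hP, h⟩
    cases h with
    | val h => cases h
    | eqT h₁ h₂ =>
      obtain ⟨rfl, rfl⟩ := eval_value_eq (Eval.isValue hP) h₁
      exact .eqT hP h₂
    | eqF h₁ h₂ h₃ =>
      obtain ⟨rfl, rfl⟩ := eval_value_eq (Eval.isValue hP) h₁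
      exact .eqF hP h₂ h₃
    | eqBoolT h₁ h₂ h₃ =>
      obtain ⟨rfl, rfl⟩ := eval_value_eq (Eval.isValue hP) h₁
      exact .eqBoolT hP h₂ h₃
    | eqBoolF h₁ h₂ h₃ =>
      obtain ⟨rfl, rfl⟩ := eval_value_eq (Eval.isValue hP) h₁
      exact .eqBoolF hP h₂ h₃

theorem isFrame_eqR {V : Tm} (hV : IsValue V) : IsFrame (Tm.eq V) := by
  intro P G G'' U
  constructor
  · intro h
    cases h with
    | val h => cases h
    | eqT h₁ h₂ =>
      obtain ⟨rfl, rfl⟩ := eval_value_eq hV h₁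
      exact ⟨_, _, h₂, .eqT (.val hV) (.val hV)⟩
    | eqF h₁ h₂ h₃ =>
      obtain ⟨rfl, rfl⟩ := eval_value_eq hV h₁
      exact ⟨_, _, h₂, .eqF (.val hV) (.val (Eval.isValue h₂)) h₃⟩
    | eqBoolT h₁ h₂ h₃ =>
      obtain ⟨rfl, rfl⟩ := eval_value_eq hV h₁
      exact ⟨_, _, h₂, .eqBoolT (.val hV) (.val hV) h₃⟩
    | eqBoolF h₁ h₂ h₃ =>
      obtain ⟨rfl, rfl⟩ := eval_value_eq hV h₁
      exact ⟨_, _, h₂, .eqBoolF (.val hV) (.val (Eval.isValue h₂)) h₃⟩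
  · rintro ⟨G', W, hP, h⟩
    have hW := Eval.isValue hP
    cases h with
    | val h => cases h
    | eqT h₁ h₂ =>
      obtain ⟨rfl, rfl⟩ := eval_value_eq hV h₁
      obtain ⟨rfl, rfl⟩ := eval_value_eq hW h₂
      exact .eqT (.val hV) hP
    | eqF h₁ h₂ h₃ =>
      obtain ⟨rfl, rfl⟩ := eval_value_eq hV h₁
      obtain ⟨rfl, rfl⟩ := eval_value_eq hW h₂
      exact .eqF (.val hV) hP h₃
    | eqBoolT h₁ h₂ h₃ =>
      obtain ⟨rfl, rfl⟩ := eval_value_eq hV h₁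
      obtain ⟨rfl, rfl⟩ := eval_value_eq hW h₂
      exact .eqBoolT (.val hV) hP h₃
    | eqBoolF h₁ h₂ h₃ =>
      obtain ⟨rfl, rfl⟩ := eval_value_eq hV h₁
      obtain ⟨rfl, rfl⟩ := eval_value_eq hW h₂
      exact .eqBoolF (.val hV) hP h₃

theorem eval_beta_iff {x : ℕ} {α : Ty} {B W U : Tm} (hW : IsValue W) {G G' : Finset ℕ} :
    Eval G (.app (.lam x α B) W) G' U ↔ Eval G (subst x W B) G' U := by
  constructor
  · intro h
    cases h with
    | val h => cases h
    | app h₁ h₂ h₃ h₄ =>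
      obtain ⟨rfl, h⟩ := eval_value_eq (.lam _ _ _) h₁
      cases h
      obtain ⟨rfl, rfl⟩ := eval_value_eq hW h₂
      exact h₄
    | gensym r h₁ => cases h₁
  · intro h
    exact .app (.val (.lam _ _ _)) (.val hW) hW h

theorem eval_letin_iff {x : ℕ} {N W U : Tm} (hW : IsValue W) {G G' : Finset ℕ} :
    Eval G (.letin x W N) G' U ↔ Eval G (subst x W N) G' U := by
  constructor
  · intro h
    cases h with
    | val h => cases h
    | letin h₁ h₂ h₃ =>
      obtain ⟨rfl, rfl⟩ := eval_value_eq hW h₁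
      exact h₃
  · intro h
    exact .letin (.val hW) hW h

theorem eval_cond_boolVal_iff {b : Bool} {N₁ N₂ U : Tm} {G G' : Finset ℕ} :
    Eval G (.cond (boolVal b) N₁ N₂) G' U ↔ Eval G (if b then N₁ else N₂) G' U := by
  cases b
  · constructor
    · intro h
      cases h with
      | val h => cases h
      | condT h₁ _ => cases h₁
      | condF h₁ h₂ => cases h₁; exact h₂
    · exact fun h => .condF (.val .ff) h
  · constructor
    · intro h
      cases h with
      | val h => cases h
      | condT h₁ h₂ => cases h₁; exact h₂
      | condF h₁ _ => cases h₁
    · exact fun h => .condT (.val .tt) h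

theorem eval_fst_pair_iff {V W U : Tm} (hV : IsValue V) (hW : IsValue W) {G G' : Finset ℕ} :
    Eval G (.fst (.pair V W)) G' U ↔ Eval G V G' U := by
  rw [eval_value_iff hV]
  constructor
  · intro h
    cases h with
    | val h => cases h
    | fst h =>
      obtain ⟨rfl, e⟩ := eval_value_eq (.pair hV hW) h
      injection e with h _
      exact ⟨rfl, h⟩
  · rintro ⟨rfl, rfl⟩
    exact .fst (.val (.pair hV hW))

theorem eval_snd_pair_iff {V W U : Tm} (hV : IsValue V) (hW : IsValue W) {G G' : Finset ℕ} :
    Eval G (.snd (.pair V W)) G' U ↔ Eval G W G' U := by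
  rw [eval_value_iff hW]
  constructor
  · intro h
    cases h with
    | val h => cases h
    | snd h =>
      obtain ⟨rfl, e⟩ := eval_value_eq (.pair hV hW) h
      injection e with _ h
      exact ⟨rfl, h⟩
  · rintro ⟨rfl, rfl⟩
    exact .snd (.val (.pair hV hW))

theorem isValue_boolVal (b : Bool) : IsValue (boolVal b) := by
  cases b
  exacts [.ff, .tt]

theorem eval_eq_names_iff {r s : ℕ} {U : Tm} {G G' : Finset ℕ} :
    Eval G (.eq (.name r) (.name s)) G' U ↔ Eval G (boolVal (decide (r = s))) G' U := by
  rw [eval_value_iff (isValue_boolVal _)]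
  constructor
  · intro h
    cases h with
    | val h => cases h
    | eqT h₁ h₂ => cases h₁; cases h₂; simp [boolVal]
    | eqF h₁ h₂ h₃ => cases h₁; cases h₂; simp [boolVal, h₃]
    | eqBoolT h₁ h₂ h₃ => cases h₁; simp at h₃
    | eqBoolF h₁ h₂ h₃ => cases h₁; simp at h₃
  · rintro ⟨rfl, rfl⟩
    by_cases h : r = s
    · subst h
      simpa [boolVal] using Eval.eqT (.val (.name r)) (.val (.name r))
    · simpa [boolVal, h] using Eval.eqF (.val (.name r)) (.val (.name s)) h

theorem eval_eq_boolVals_iff {a b : Bool} {U : Tm} {G G' : Finset ℕ} :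
    Eval G (.eq (boolVal a) (boolVal b)) G' U ↔ Eval G (boolVal (a == b)) G' U := by
  rw [eval_value_iff (isValue_boolVal _)]
  constructor
  · intro h
    cases h with
    | val h => cases h
    | eqT h₁ h₂ => cases a <;> cases h₁
    | eqF h₁ h₂ h₃ => cases a <;> cases h₁
    | eqBoolT h₁ h₂ h₃ => cases a <;> cases b <;> cases h₁ <;> cases h₂ <;> simp [boolVal]
    | eqBoolF h₁ h₂ h₃ =>
      cases a <;> cases b <;> cases h₁ <;> cases h₂ <;> simp [boolVal] at h₃ ⊢
  · rintro ⟨rfl, rfl⟩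
    cases a <;> cases b
    · exact .eqBoolT (.val .ff) (.val .ff) (.inr rfl)
    · exact .eqBoolF (.val .ff) (.val .tt) (.inr ⟨rfl, rfl⟩)
    · exact .eqBoolF (.val .tt) (.val .ff) (.inl ⟨rfl, rfl⟩)
    · exact .eqBoolT (.val .tt) (.val .tt) (.inl rfl)

theorem eval_gensym_iff {U : Tm} {G G' : Finset ℕ} :
    Eval G (.app .gensym .unit) G' U ↔ ∃ r ∉ G, G' = insert r G ∧ U = .name r := by
  constructor
  · intro h
    cases h with
    | val h => cases h
    | app h₁ => cases h₁
    | gensym r h₁ h₂ h₃ => cases h₁; cases h₂; exact ⟨r, h₃, rfl, rfl⟩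
  · rintro ⟨r, hr, rfl, rfl⟩
    exact .gensym r (.val .gensym) (.val .unit) hr

/-! ### Parallel substitution -/

/-- Semantic closedness: invariance under every substitution. -/
def Closed (M : Tm) : Prop := ∀ x U, subst x U M = M

theorem closed_boolVal (b : Bool) : Closed (boolVal b) := by
  cases b <;> intro x U <;> rfl

/-- Capture-permitting parallel substitution. -/
def psubst (σ : ℕ → Tm) : Tm → Tm
  | .var y => σ y
  | .lam y α M => .lam y α (psubst (Function.update σ y (.var y)) M)
  | .app M N => .app (psubst σ M) (psubst σ N)
  | .pair M N => .pair (psubst σ M) (psubst σ N)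
  | .fst M => .fst (psubst σ M)
  | .snd M => .snd (psubst σ M)
  | .cond M N₁ N₂ => .cond (psubst σ M) (psubst σ N₁) (psubst σ N₂)
  | .letin y M N => .letin y (psubst σ M) (psubst (Function.update σ y (.var y)) N)
  | .eq M N => .eq (psubst σ M) (psubst σ N)
  | t => t

theorem psubst_var (M : Tm) : psubst Tm.var M = M := by
  have h (y : ℕ) : Function.update Tm.var y (.var y) = Tm.var := Function.update_eq_self _ _
  induction M <;> simp_all [psubst]

theorem subst_psubst {x : ℕ} {W : Tm} (M : Tm) :
    ∀ {σ : ℕ → Tm}, (∀ y, y ≠ x → subst x W (σ y) = σ y) →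
      subst x W (psubst σ M) = psubst (Function.update σ x (subst x W (σ x))) M := by
  have upd_ne {σ : ℕ → Tm} {y : ℕ} (hσ : ∀ z, z ≠ x → subst x W (σ z) = σ z) (hy : y ≠ x) :
      ∀ z, z ≠ x → subst x W (Function.update σ y (.var y) z) =
        Function.update σ y (.var y) z := by
    intro z hz
    by_cases hzy : z = y
    · subst hzy; simp [subst, hy]
    · simp [hzy, hσ z hz]
  induction M with
  | var y =>
    intro σ hσ
    by_cases h : y = x
    · subst h; simp [psubst]
    · simp [psubst, h, hσ y h]
  | lam y α M ih =>
    intro σ hσ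
    by_cases h : y = x
    · subst h; simp [psubst, subst]
    · simp only [psubst, subst, h, if_false, ih (upd_ne hσ h)]
      rw [Function.update_comm h, Function.update_of_ne (Ne.symm h)]
  | letin y M N ihM ihN =>
    intro σ hσ
    by_cases h : y = x
    · subst h; simp [psubst, subst, ihM hσ]
    · simp only [psubst, subst, h, if_false, ihN (upd_ne hσ h), ihM hσ]
      rw [Function.update_comm h, Function.update_of_ne (Ne.symm h)]
  | _ => intro σ hσ; simp_all [psubst, subst]

theorem subst_eq_psubst (x : ℕ) (W M : Tm) :
    subst x W M = psubst (Function.update Tm.var x W) M := by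
  have := subst_psubst (x := x) (W := W) M (σ := Tm.var) (fun y hy => by simp [subst, hy])
  simpa [psubst_var, subst] using this

theorem subst_psubst_update {x : ℕ} {W : Tm} {σ : ℕ → Tm}
    (hσ : ∀ y, y ≠ x → subst x W (σ y) = σ y) (M : Tm) :
    subst x W (psubst (Function.update σ x (.var x)) M) = psubst (Function.update σ x W) M := by
  rw [subst_psubst]
  · simp [subst]
  · intro y hy
    simp [hy, hσ y hy]

theorem lookupVar_append (Γ : Ctx) (x : ℕ) (α : Ty) (y : ℕ) :
    lookupVar (Γ ++ [(x, α)]) y = if y = x then some α else lookupVar Γ y := by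
  by_cases h : y = x
  · simp [lookupVar, h]
  · have h' : x ≠ y := fun e => h e.symm
    simp [lookupVar, h, h']

theorem subst_psubst_of_typed {Γ : Ctx} {M : Tm} {τ : Ty} (hM : Typed Γ M τ) {z : ℕ} {U : Tm} :
    ∀ {σ : ℕ → Tm}, (∀ y α, lookupVar Γ y = some α → subst z U (σ y) = σ y) →
      subst z U (psubst σ M) = psubst σ M := by
  have extend {Γ : Ctx} {x : ℕ} {α : Ty} {σ : ℕ → Tm} (hx : x ≠ z)
      (hσ : ∀ y α, lookupVar Γ y = some α → subst z U (σ y) = σ y) (y : ℕ) (β : Ty)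
      (hy : lookupVar (Γ ++ [(x, α)]) y = some β) :
      subst z U (Function.update σ x (.var x) y) = Function.update σ x (.var x) y := by
    rw [lookupVar_append] at hy
    by_cases h : y = x
    · subst h; simp [subst, hx]
    · simp only [h, if_false] at hy
      simp [h, hσ y β hy]
  induction hM with
  | var h => intro σ hσ; exact hσ _ _ h
  | @lam Γ x α β M _ ih =>
    intro σ hσ
    by_cases h : x = z
    · simp [psubst, subst, h]
    · simp [psubst, subst, h, ih (extend h hσ)]
  | @letin Γ x M N α β _ _ ihM ihN =>
    intro σ hσ
    by_cases h : x = z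
    · simp [psubst, subst, h, ihM hσ]
    · simp [psubst, subst, h, ihM hσ, ihN (extend h hσ)]
  | _ => intro σ hσ; simp_all [psubst, subst]

theorem closed_psubst {Γ : Ctx} {M : Tm} {τ : Ty} (hM : Typed Γ M τ) {σ : ℕ → Tm}
    (hσ : ∀ y α, lookupVar Γ y = some α → Closed (σ y)) : Closed (psubst σ M) :=
  fun z U => subst_psubst_of_typed hM fun y α h => hσ y α h z U

theorem closed_of_typed {M : Tm} {τ : Ty} (hM : Typed [] M τ) : Closed M := by
  simpa [psubst_var] using closed_psubst hM (σ := Tm.var) (by simp [lookupVar])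

/-! ### The logical relation -/

/-- A partial bijection between two finite sets of names. -/
structure World where
  rel : ℕ → ℕ → Prop
  left : Finset ℕ
  right : Finset ℕ
  left_mem : ∀ {r s}, rel r s → r ∈ left
  right_mem : ∀ {r s}, rel r s → s ∈ right
  bij : ∀ {r s r' s'}, rel r s → rel r' s' → (r = r' ↔ s = s')

instance : Preorder World where
  le w w' := (∀ r s, w.rel r s → w'.rel r s) ∧ w.left ⊆ w'.left ∧ w.right ⊆ w'.right
  le_refl w := ⟨fun _ _ h => h, subset_rfl, subset_rfl⟩
  le_trans _ _ _ h₁ h₂ :=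
    ⟨fun r s h => h₂.1 r s (h₁.1 r s h), h₁.2.1.trans h₂.2.1, h₁.2.2.trans h₂.2.2⟩

/-- Enlarge the two name sets without relating new names. -/
def World.grow (w : World) {G₁ G₂ : Finset ℕ} (h₁ : w.left ⊆ G₁) (h₂ : w.right ⊆ G₂) : World where
  rel := w.rel
  left := G₁
  right := G₂
  left_mem h := h₁ (w.left_mem h)
  right_mem h := h₂ (w.right_mem h)
  bij := w.bij

theorem World.le_grow (w : World) {G₁ G₂ : Finset ℕ} (h₁ : w.left ⊆ G₁) (h₂ : w.right ⊆ G₂) :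
    w ≤ w.grow h₁ h₂ :=
  ⟨fun _ _ h => h, h₁, h₂⟩

/-- The identity relation on a set of names. -/
def World.diag (G : Finset ℕ) : World where
  rel r s := r = s ∧ r ∈ G
  left := G
  right := G
  left_mem h := h.2
  right_mem h := h.1 ▸ h.2
  bij h k := by rw [h.1, k.1]

/-- Relate a fresh name on the left to a fresh name on the right. -/
def World.link (w : World) {r s : ℕ} (hr : r ∉ w.left) (hs : s ∉ w.right) : World where
  rel r' s' := w.rel r' s' ∨ (r' = r ∧ s' = s)
  left := insert r w.left
  right := insert s w.right
  left_mem := by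
    rintro r' s' (h | ⟨rfl, rfl⟩)
    · exact Finset.mem_insert_of_mem (w.left_mem h)
    · exact Finset.mem_insert_self _ _
  right_mem := by
    rintro r' s' (h | ⟨rfl, rfl⟩)
    · exact Finset.mem_insert_of_mem (w.right_mem h)
    · exact Finset.mem_insert_self _ _
  bij := by
    rintro r₁ s₁ r₂ s₂ (h₁ | ⟨rfl, rfl⟩) (h₂ | ⟨rfl, rfl⟩)
    · exact w.bij h₁ h₂
    · exact ⟨fun e => absurd (e ▸ w.left_mem h₁) hr, fun e => absurd (e ▸ w.right_mem h₁) hs⟩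
    · exact ⟨fun e => absurd (e ▸ w.left_mem h₂) hr, fun e => absurd (e ▸ w.right_mem h₂) hs⟩
    · simp

theorem World.le_link (w : World) {r s : ℕ} (hr : r ∉ w.left) (hs : s ∉ w.right) :
    w ≤ w.link hr hs :=
  ⟨fun _ _ h => .inl h, Finset.subset_insert _ _, Finset.subset_insert _ _⟩

/-- Two expressions are related when both terminate and all their results are related
in some future world. -/
def ExpRel (S : World → Tm → Tm → Prop) (w : World) (P Q : Tm) : Prop :=
  (∃ G V, Eval w.left P G V) ∧ (∃ G V, Eval w.right Q G V) ∧
    ∀ G₁ V G₂ W, Eval w.left P G₁ V → Eval w.right Q G₂ W →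
      ∃ v ≥ w, v.left = G₁ ∧ v.right = G₂ ∧ S v V W

/-- The logical relation on closed values. -/
def ValRel : Ty → World → Tm → Tm → Prop
  | .unit, _, V, W => V = .unit ∧ W = .unit
  | .bool, _, V, W => ∃ b, V = boolVal b ∧ W = boolVal b
  | .nm, w, V, W => ∃ r s, w.rel r s ∧ V = .name r ∧ W = .name s
  | .prod α β, w, V, W => ∃ V₁ V₂ W₁ W₂, ValRel α w V₁ W₁ ∧ ValRel β w V₂ W₂ ∧
      V = .pair V₁ V₂ ∧ W = .pair W₁ W₂
  | .arrow α β, w, V, W => IsValue V ∧ IsValue W ∧ Closed V ∧ Closed W ∧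
      ∀ w' ≥ w, ∀ A B, ValRel α w' A B → ExpRel (ValRel β) w' (.app V A) (.app W B)

theorem ValRel.mono {α : Ty} : ∀ {w w' : World} {V W : Tm}, w ≤ w' → ValRel α w V W →
    ValRel α w' V W := by
  induction α with
  | unit => exact fun _ h => h
  | bool => exact fun _ h => h
  | nm => rintro w w' V W hw ⟨r, s, h, e⟩; exact ⟨r, s, hw.1 _ _ h, e⟩
  | prod α β ihα ihβ =>
    rintro w w' V W hw ⟨V₁, V₂, W₁, W₂, h₁, h₂, e⟩
    exact ⟨V₁, V₂, W₁, W₂, ihα hw h₁, ihβ hw h₂, e⟩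
  | arrow α β =>
    rintro w w' V W hw ⟨h₁, h₂, h₃, h₄, h⟩
    exact ⟨h₁, h₂, h₃, h₄, fun w'' hw' => h w'' (hw.trans hw')⟩

theorem ValRel.isValue {α : Ty} : ∀ {w : World} {V W : Tm}, ValRel α w V W →
    IsValue V ∧ IsValue W := by
  induction α with
  | unit => rintro w V W ⟨rfl, rfl⟩; exact ⟨.unit, .unit⟩
  | bool => rintro w V W ⟨b, rfl, rfl⟩; exact ⟨isValue_boolVal b, isValue_boolVal b⟩
  | nm => rintro w V W ⟨r, s, _, rfl, rfl⟩; exact ⟨.name r, .name s⟩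
  | prod α β ihα ihβ =>
    rintro w V W ⟨V₁, V₂, W₁, W₂, h₁, h₂, rfl, rfl⟩
    exact ⟨.pair (ihα h₁).1 (ihβ h₂).1, .pair (ihα h₁).2 (ihβ h₂).2⟩
  | arrow α β => exact fun h => ⟨h.1, h.2.1⟩

theorem ValRel.closed {α : Ty} : ∀ {w : World} {V W : Tm}, ValRel α w V W →
    Closed V ∧ Closed W := by
  induction α with
  | unit => rintro w V W ⟨rfl, rfl⟩; exact ⟨fun _ _ => rfl, fun _ _ => rfl⟩
  | bool => rintro w V W ⟨b, rfl, rfl⟩; exact ⟨closed_boolVal b, closed_boolVal b⟩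
  | nm => rintro w V W ⟨r, s, _, rfl, rfl⟩; exact ⟨fun _ _ => rfl, fun _ _ => rfl⟩
  | prod α β ihα ihβ =>
    rintro w V W ⟨V₁, V₂, W₁, W₂, h₁, h₂, rfl, rfl⟩
    constructor <;> intro x U
    · simp [subst, (ihα h₁).1 x U, (ihβ h₂).1 x U]
    · simp [subst, (ihα h₁).2 x U, (ihβ h₂).2 x U]
  | arrow α β => exact fun h => ⟨h.2.2.1, h.2.2.2.1⟩

theorem ValRel.expRel {α : Ty} {w : World} {V W : Tm} (h : ValRel α w V W) :
    ExpRel (ValRel α) w V W := by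
  obtain ⟨hV, hW⟩ := h.isValue
  refine ⟨⟨_, _, .val hV⟩, ⟨_, _, .val hW⟩, fun G₁ V' G₂ W' h₁ h₂ => ?_⟩
  obtain ⟨rfl, rfl⟩ := eval_value_eq hV h₁
  obtain ⟨rfl, rfl⟩ := eval_value_eq hW h₂
  exact ⟨w, le_rfl, rfl, rfl, h⟩

theorem ExpRel.bind {S T : World → Tm → Tm → Prop} {K L : Tm → Tm} (hK : IsFrame K)
    (hL : IsFrame L) {w : World} {P Q : Tm} (h : ExpRel S w P Q)
    (hST : ∀ w' ≥ w, ∀ V W, S w' V W → ExpRel T w' (K V) (L W)) :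
    ExpRel T w (K P) (L Q) := by
  obtain ⟨⟨G₁, V, hV⟩, ⟨G₂, W, hW⟩, h⟩ := h
  refine ⟨?_, ?_, ?_⟩
  · obtain ⟨w', hw, rfl, rfl, hS⟩ := h _ _ _ _ hV hW
    obtain ⟨⟨G, U, hU⟩, _⟩ := hST w' hw _ _ hS
    exact ⟨G, U, (hK _ _ _ _).2 ⟨_, _, hV, hU⟩⟩
  · obtain ⟨w', hw, rfl, rfl, hS⟩ := h _ _ _ _ hV hW
    obtain ⟨_, ⟨G, U, hU⟩, _⟩ := hST w' hw _ _ hS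
    exact ⟨G, U, (hL _ _ _ _).2 ⟨_, _, hW, hU⟩⟩
  · intro G₁' V' G₂' W' hV' hW'
    obtain ⟨_, _, hP, hV'⟩ := (hK _ _ _ _).1 hV'
    obtain ⟨_, _, hQ, hW'⟩ := (hL _ _ _ _).1 hW'
    obtain ⟨w', hw, rfl, rfl, hS⟩ := h _ _ _ _ hP hQ
    obtain ⟨w'', hw', e₁, e₂, hT⟩ := (hST w' hw _ _ hS).2.2 _ _ _ _ hV' hW'
    exact ⟨w'', hw.trans hw', e₁, e₂, hT⟩

theorem ExpRel.of_eval_iff {S : World → Tm → Tm → Prop} {w : World} {P P' Q Q' : Tm}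
    (h : ExpRel S w P' Q') (hP : ∀ {G G' U}, Eval G P G' U ↔ Eval G P' G' U)
    (hQ : ∀ {G G' U}, Eval G Q G' U ↔ Eval G Q' G' U) : ExpRel S w P Q := by
  simpa only [ExpRel, hP, hQ] using h

/-- Related substitutions of closed expressions for the variables in `Γ`. -/
def EnvRel (w : World) (Γ : Ctx) (σ τ : ℕ → Tm) : Prop :=
  ∀ y α, lookupVar Γ y = some α → Closed (σ y) ∧ Closed (τ y) ∧
    ∀ w' ≥ w, ExpRel (ValRel α) w' (σ y) (τ y)

theorem EnvRel.mono {w w' : World} {Γ : Ctx} {σ τ : ℕ → Tm} (hw : w ≤ w')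
    (h : EnvRel w Γ σ τ) : EnvRel w' Γ σ τ := fun y α hy =>
  ⟨(h y α hy).1, (h y α hy).2.1, fun w'' hw' => (h y α hy).2.2 w'' (hw.trans hw')⟩

theorem EnvRel.update {w : World} {Γ : Ctx} {σ τ : ℕ → Tm} {x : ℕ} {α : Ty} {P Q : Tm}
    (h : EnvRel w Γ σ τ) (hP : Closed P) (hQ : Closed Q)
    (hPQ : ∀ w' ≥ w, ExpRel (ValRel α) w' P Q) :
    EnvRel w (Γ ++ [(x, α)]) (Function.update σ x P) (Function.update τ x Q) := by
  intro y β hy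
  rw [lookupVar_append] at hy
  by_cases hyx : y = x
  · subst hyx
    simp only [if_true, Option.some.injEq] at hy
    subst hy
    simpa using ⟨hP, hQ, hPQ⟩
  · simp only [hyx, if_false] at hy
    simpa [hyx] using h y β hy

/-- Substituting for `x` affects no entry of `σ` other than possibly `σ x`. -/
def Tame (σ : ℕ → Tm) : Prop := ∀ x U y, y ≠ x → subst x U (σ y) = σ y

theorem tame_var : Tame Tm.var := fun x U y hy => by simp [subst, hy]

theorem Tame.update {σ : ℕ → Tm} (hσ : Tame σ) {P : Tm} (hP : Closed P) (x : ℕ) :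
    Tame (Function.update σ x P) := by
  intro z U y hy
  by_cases h : y = x
  · subst h; simp [hP z U]
  · simp [h, hσ z U y hy]

theorem expRel_gensym {w : World} :
    ExpRel (ValRel .nm) w (.app .gensym .unit) (.app .gensym .unit) := by
  obtain ⟨r, hr⟩ := Infinite.exists_notMem_finset w.left
  obtain ⟨s, hs⟩ := Infinite.exists_notMem_finset w.right
  simp only [ExpRel, eval_gensym_iff]
  refine ⟨⟨_, _, r, hr, rfl, rfl⟩, ⟨_, _, s, hs, rfl, rfl⟩, ?_⟩
  rintro _ _ _ _ ⟨r, hr, rfl, rfl⟩ ⟨s, hs, rfl, rfl⟩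
  exact ⟨w.link hr hs, w.le_link hr hs, rfl, rfl, r, s, .inr ⟨rfl, rfl⟩, rfl, rfl⟩

/-- The fundamental theorem of the logical relation. -/
theorem expRel_psubst {Γ : Ctx} {M : Tm} {α : Ty} (hM : Typed Γ M α) :
    ∀ {w : World} {σ τ : ℕ → Tm}, Tame σ → Tame τ → EnvRel w Γ σ τ →
      (∀ r ∈ AN M, w.rel r r) → ExpRel (ValRel α) w (psubst σ M) (psubst τ M) := by
  induction hM with
  | var h =>
    intro w σ τ _ _ hE _
    exact (hE _ _ h).2.2 w le_rfl
  | unit => intros; exact ValRel.expRel ⟨rfl, rfl⟩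
  | tt => intros; exact ValRel.expRel ⟨true, rfl, rfl⟩
  | ff => intros; exact ValRel.expRel ⟨false, rfl, rfl⟩
  | name r =>
    intro w σ τ _ _ _ hR
    exact ValRel.expRel ⟨r, r, hR r (by simp [AN]), rfl, rfl⟩
  | gensym =>
    intro w σ τ _ _ _ _
    refine ValRel.expRel ⟨.gensym, .gensym, fun _ _ => rfl, fun _ _ => rfl, ?_⟩
    rintro w' _ _ _ ⟨rfl, rfl⟩
    exact expRel_gensym
  | @lam Γ x α β M hM ih =>
    intro w σ τ hσ hτ hE hR
    refine ValRel.expRel ⟨.lam _ _ _, .lam _ _ _, closed_psubst hM.lam fun y α h => (hE y α h).1,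
      closed_psubst hM.lam fun y α h => (hE y α h).2.1, fun w' hw A B hAB => ?_⟩
    refine ExpRel.of_eval_iff ?_ (eval_beta_iff hAB.isValue.1) (eval_beta_iff hAB.isValue.2)
    rw [subst_psubst_update (hσ x A), subst_psubst_update (hτ x B)]
    exact ih (hσ.update hAB.closed.1 x) (hτ.update hAB.closed.2 x)
      ((hE.mono hw).update hAB.closed.1 hAB.closed.2 fun w'' hw' => (hAB.mono hw').expRel)
      fun r hr => hw.1 _ _ (hR r hr)
  | app _ _ ihM ihN =>
    intro w σ τ hσ hτ hE hR
    simp only [AN, Finset.mem_union] at hR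
    refine ExpRel.bind (isFrame_appL _) (isFrame_appL _)
      (ihM hσ hτ hE fun r hr => hR r (.inl hr)) fun w₁ hw₁ V W hVW => ?_
    refine ExpRel.bind (isFrame_appR hVW.1) (isFrame_appR hVW.2.1)
      (ihN hσ hτ (hE.mono hw₁) fun r hr => hw₁.1 _ _ (hR r (.inr hr))) fun w₂ hw₂ A B hAB => ?_
    exact hVW.2.2.2.2 w₂ hw₂ A B hAB
  | pair _ _ ihM ihN =>
    intro w σ τ hσ hτ hE hR
    simp only [AN, Finset.mem_union] at hR
    refine ExpRel.bind (isFrame_pairL _) (isFrame_pairL _)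
      (ihM hσ hτ hE fun r hr => hR r (.inl hr)) fun w₁ hw₁ V W hVW => ?_
    refine ExpRel.bind (isFrame_pairR hVW.isValue.1) (isFrame_pairR hVW.isValue.2)
      (ihN hσ hτ (hE.mono hw₁) fun r hr => hw₁.1 _ _ (hR r (.inr hr))) fun w₂ hw₂ A B hAB => ?_
    exact ValRel.expRel ⟨_, _, _, _, hVW.mono hw₂, hAB, rfl, rfl⟩
  | fst _ ih =>
    intro w σ τ hσ hτ hE hR
    refine ExpRel.bind isFrame_fst isFrame_fst (ih hσ hτ hE hR) ?_
    rintro w₁ hw₁ _ _ ⟨V₁, V₂, W₁, W₂, h₁, h₂, rfl, rfl⟩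
    exact h₁.expRel.of_eval_iff (eval_fst_pair_iff h₁.isValue.1 h₂.isValue.1)
      (eval_fst_pair_iff h₁.isValue.2 h₂.isValue.2)
  | snd _ ih =>
    intro w σ τ hσ hτ hE hR
    refine ExpRel.bind isFrame_snd isFrame_snd (ih hσ hτ hE hR) ?_
    rintro w₁ hw₁ _ _ ⟨V₁, V₂, W₁, W₂, h₁, h₂, rfl, rfl⟩
    exact h₂.expRel.of_eval_iff (eval_snd_pair_iff h₁.isValue.1 h₂.isValue.1)
      (eval_snd_pair_iff h₁.isValue.2 h₂.isValue.2)
  | cond _ _ _ ihM ihN₁ ihN₂ =>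
    intro w σ τ hσ hτ hE hR
    simp only [AN, Finset.mem_union] at hR
    refine ExpRel.bind (isFrame_cond _ _) (isFrame_cond _ _)
      (ihM hσ hτ hE fun r hr => hR r (.inl (.inl hr))) ?_
    rintro w₁ hw₁ _ _ ⟨b, rfl, rfl⟩
    refine ExpRel.of_eval_iff ?_ eval_cond_boolVal_iff eval_cond_boolVal_iff
    cases b
    · exact ihN₂ hσ hτ (hE.mono hw₁) fun r hr => hw₁.1 _ _ (hR r (.inr hr))
    · exact ihN₁ hσ hτ (hE.mono hw₁) fun r hr => hw₁.1 _ _ (hR r (.inl (.inr hr)))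
  | @letin Γ x M N α β _ _ ihM ihN =>
    intro w σ τ hσ hτ hE hR
    simp only [AN, Finset.mem_union] at hR
    refine ExpRel.bind (isFrame_letin _ _) (isFrame_letin _ _)
      (ihM hσ hτ hE fun r hr => hR r (.inl hr)) fun w₁ hw A B hAB => ?_
    refine ExpRel.of_eval_iff ?_ (eval_letin_iff hAB.isValue.1) (eval_letin_iff hAB.isValue.2)
    rw [subst_psubst_update (hσ x A), subst_psubst_update (hτ x B)]
    exact ihN (hσ.update hAB.closed.1 x) (hτ.update hAB.closed.2 x)
      ((hE.mono hw).update hAB.closed.1 hAB.closed.2 fun w'' hw' => (hAB.mono hw').expRel)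
      fun r hr => hw.1 _ _ (hR r (.inr hr))
  | eqNm _ _ ihM ihN =>
    intro w σ τ hσ hτ hE hR
    simp only [AN, Finset.mem_union] at hR
    refine ExpRel.bind (isFrame_eqL _) (isFrame_eqL _)
      (ihM hσ hτ hE fun r hr => hR r (.inl hr)) fun w₁ hw₁ V W hVW => ?_
    refine ExpRel.bind (isFrame_eqR hVW.isValue.1) (isFrame_eqR hVW.isValue.2)
      (ihN hσ hτ (hE.mono hw₁) fun r hr => hw₁.1 _ _ (hR r (.inr hr))) fun w₂ hw₂ A B hAB => ?_
    obtain ⟨r, s, h, rfl, rfl⟩ := hVW.mono hw₂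
    obtain ⟨r', s', h', rfl, rfl⟩ := hAB
    refine ExpRel.of_eval_iff (ValRel.expRel ?_) eval_eq_names_iff eval_eq_names_iff
    exact ⟨_, rfl, by simp only [w₂.bij h h']⟩
  | eqBool _ _ ihM ihN =>
    intro w σ τ hσ hτ hE hR
    simp only [AN, Finset.mem_union] at hR
    refine ExpRel.bind (isFrame_eqL _) (isFrame_eqL _)
      (ihM hσ hτ hE fun r hr => hR r (.inl hr)) fun w₁ hw₁ V W hVW => ?_
    refine ExpRel.bind (isFrame_eqR hVW.isValue.1) (isFrame_eqR hVW.isValue.2)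
      (ihN hσ hτ (hE.mono hw₁) fun r hr => hw₁.1 _ _ (hR r (.inr hr))) fun w₂ hw₂ A B hAB => ?_
    obtain ⟨a, rfl, rfl⟩ := hVW
    obtain ⟨b, rfl, rfl⟩ := hAB
    exact ExpRel.of_eval_iff (ValRel.expRel ⟨_, rfl, rfl⟩) eval_eq_boolVals_iff
      eval_eq_boolVals_iff

theorem expRel_self {M : Tm} {α : Ty} (hM : Typed [] M α) {w : World}
    (hR : ∀ r ∈ AN M, w.rel r r) : ExpRel (ValRel α) w M M := by
  simpa [psubst_var] using expRel_psubst hM tame_var tame_var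
    (by intro y α hy; simp [lookupVar] at hy) hR

/-! ### The finite set-theoretic model -/

/-- The full set-theoretic type hierarchy over the booleans; `Nm` is given a dummy
one-point interpretation. -/
def Den : Ty → Type
  | .unit => Unit
  | .bool => Bool
  | .nm => Unit
  | .prod α β => Den α × Den β
  | .arrow α β => Den α → Den β

instance Den.finite : ∀ α, Finite (Den α)
  | .unit => inferInstanceAs (Finite Unit)
  | .bool => inferInstanceAs (Finite Bool)
  | .nm => inferInstanceAs (Finite Unit)
  | .prod α β =>
    have := Den.finite α
    have := Den.finite β
    inferInstanceAs (Finite (Den α × Den β))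
  | .arrow α β =>
    have := Den.finite α
    have := Den.finite β
    inferInstanceAs (Finite (Den α → Den β))

noncomputable instance (α : Ty) : Fintype (Den α) := Fintype.ofFinite _

def Den.default : ∀ α, Den α
  | .unit => ()
  | .bool => true
  | .nm => ()
  | .prod α β => (Den.default α, Den.default β)
  | .arrow _ β => fun _ => Den.default β

/-- `P` terminates from `G` and all its results satisfy `S`. -/
def ExpSat (S : Finset ℕ → Tm → Prop) (G : Finset ℕ) (P : Tm) : Prop :=
  (∃ H V, Eval G P H V) ∧ ∀ H V, Eval G P H V → G ⊆ H ∧ S H V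

/-- The value `V` behaves as the semantic element `d` whenever the names in `G` are
already allocated. -/
def Realizes : (α : Ty) → Den α → Finset ℕ → Tm → Prop
  | .unit, _, _, V => V = .unit
  | .bool, b, _, V => V = boolVal b
  | .nm, _, _, V => V = .name 0
  | .prod α β, d, G, V => ∃ V₁ V₂, Realizes α d.1 G V₁ ∧ Realizes β d.2 G V₂ ∧ V = .pair V₁ V₂
  | .arrow α β, f, G, V => IsValue V ∧ Closed V ∧
      ∀ G', G ⊆ G' → ∀ a A, Realizes α a G' A → ExpSat (Realizes β (f a)) G' (.app V A)

theorem Realizes.mono {α : Ty} : ∀ {d : Den α} {G G' : Finset ℕ} {V : Tm}, G ⊆ G' →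
    Realizes α d G V → Realizes α d G' V := by
  induction α with
  | unit => exact fun _ h => h
  | bool => exact fun _ h => h
  | nm => exact fun _ h => h
  | prod α β ihα ihβ =>
    rintro d G G' V hG ⟨V₁, V₂, h₁, h₂, e⟩
    exact ⟨V₁, V₂, ihα hG h₁, ihβ hG h₂, e⟩
  | arrow α β =>
    rintro d G G' V hG ⟨h₁, h₂, h⟩
    exact ⟨h₁, h₂, fun G'' hG' => h G'' (hG.trans hG')⟩

theorem Realizes.isValue {α : Ty} : ∀ {d : Den α} {G : Finset ℕ} {V : Tm},
    Realizes α d G V → IsValue V := by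
  induction α with
  | unit => rintro d G V rfl; exact .unit
  | bool => rintro d G V rfl; exact isValue_boolVal d
  | nm => rintro d G V rfl; exact .name 0
  | prod α β ihα ihβ =>
    rintro d G V ⟨V₁, V₂, h₁, h₂, rfl⟩
    exact .pair (ihα h₁) (ihβ h₂)
  | arrow α β => exact fun h => h.1

theorem Realizes.expSat {α : Ty} {d : Den α} {G : Finset ℕ} {V : Tm} (h : Realizes α d G V) :
    ExpSat (Realizes α d) G V := by
  refine ⟨⟨_, _, .val h.isValue⟩, fun G' U hU => ?_⟩
  obtain ⟨rfl, rfl⟩ := eval_value_eq h.isValue hU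
  exact ⟨subset_rfl, h⟩

theorem ExpSat.bind {S T : Finset ℕ → Tm → Prop} {K : Tm → Tm} (hK : IsFrame K)
    {G : Finset ℕ} {P : Tm} (h : ExpSat S G P)
    (hST : ∀ G', G ⊆ G' → ∀ V, S G' V → ExpSat T G' (K V)) : ExpSat T G (K P) := by
  obtain ⟨⟨G₁, V, hV⟩, h⟩ := h
  constructor
  · obtain ⟨hG, hS⟩ := h _ _ hV
    obtain ⟨⟨G₂, U, hU⟩, _⟩ := hST _ hG _ hS
    exact ⟨G₂, U, (hK _ _ _ _).2 ⟨_, _, hV, hU⟩⟩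
  · intro G₂ U hU
    obtain ⟨_, _, hP, hU⟩ := (hK _ _ _ _).1 hU
    obtain ⟨hG, hS⟩ := h _ _ hP
    obtain ⟨hG', hT⟩ := (hST _ hG _ hS).2 _ _ hU
    exact ⟨hG.trans hG', hT⟩

theorem ExpSat.of_eval_iff {S : Finset ℕ → Tm → Prop} {G : Finset ℕ} {P P' : Tm}
    (h : ExpSat S G P') (hP : ∀ {G G' U}, Eval G P G' U ↔ Eval G P' G' U) : ExpSat S G P := by
  simpa only [ExpSat, hP] using h

theorem ExpSat.cond {S : Finset ℕ → Tm → Prop} {G : Finset ℕ} {P N₁ N₂ : Tm} {b : Bool}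
    (h : ExpSat (Realizes .bool b) G P)
    (hb : ∀ G', G ⊆ G' → ExpSat S G' (if b then N₁ else N₂)) : ExpSat S G (.cond P N₁ N₂) := by
  refine h.bind (isFrame_cond _ _) ?_
  rintro G' hG _ rfl
  exact (hb G' hG).of_eval_iff eval_cond_boolVal_iff

/-! ### Definability of the finite model -/

/-- The term denoting `d`, and the test comparing a term with `d`. -/
noncomputable def code : (α : Ty) → (Den α → Tm) × (Den α → Tm → Tm)
  | .unit => (fun _ => .unit, fun _ _ => .tt)
  | .bool => (fun b => boolVal b, fun b t => .cond t (boolVal b) (boolVal !b))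
  | .nm => (fun _ => .name 0, fun _ _ => .tt)
  | .prod α β =>
    (fun d => .pair ((code α).1 d.1) ((code β).1 d.2),
      fun d t => .cond ((code α).2 d.1 (.fst t)) ((code β).2 d.2 (.snd t)) .ff)
  | .arrow α β =>
    (fun f => .lam 0 α ((Finset.univ : Finset (Den α)).toList.foldr
        (fun a r => .cond ((code α).2 a (.var 0)) ((code β).1 (f a)) r)
        ((code β).1 (Den.default β))),
      fun f t => (Finset.univ : Finset (Den α)).toList.foldr
        (fun a r => .cond ((code β).2 (f a) (.app t ((code α).1 a))) r .ff) .tt)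

/-- The closed value defining `d`. -/
noncomputable def quote {α : Ty} (d : Den α) : Tm := (code α).1 d

/-- The boolean term deciding whether `t` denotes `d`. -/
noncomputable def test {α : Ty} (d : Den α) (t : Tm) : Tm := (code α).2 d t

theorem foldr_cond_typed {δ : Type} {Γ : Ctx} {τ : Ty} {c : δ → Tm} {f : δ → Tm → Tm}
    {g : δ → Tm → Tm} {z : Tm} (hc : ∀ a, Typed Γ (c a) .bool)
    (hf : ∀ a r, Typed Γ r τ → Typed Γ (f a r) τ) (hg : ∀ a r, Typed Γ r τ → Typed Γ (g a r) τ)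
    (hz : Typed Γ z τ) (l : List δ) :
    Typed Γ (l.foldr (fun a r => .cond (c a) (f a r) (g a r)) z) τ := by
  induction l with
  | nil => exact hz
  | cons a l ih => exact .cond (hc a) (hf a _ ih) (hg a _ ih)

theorem typed_code (α : Ty) : (∀ d Γ, Typed Γ ((code α).1 d) α) ∧
    ∀ d Γ t, Typed Γ t α → Typed Γ ((code α).2 d t) .bool := by
  have hbool (b : Bool) (Γ : Ctx) : Typed Γ (boolVal b) .bool := by
    cases b
    exacts [.ff, .tt]
  induction α with
  | unit => exact ⟨fun _ _ => .unit, fun _ _ _ _ => .tt⟩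
  | bool => exact ⟨fun b Γ => hbool b Γ, fun b Γ t ht => .cond ht (hbool _ _) (hbool _ _)⟩
  | nm => exact ⟨fun _ _ => .name 0, fun _ _ _ _ => .tt⟩
  | prod α β ihα ihβ =>
    exact ⟨fun d Γ => .pair (ihα.1 _ _) (ihβ.1 _ _),
      fun d Γ t ht => .cond (ihα.2 _ _ _ ht.fst) (ihβ.2 _ _ _ ht.snd) .ff⟩
  | arrow α β ihα ihβ =>
    refine ⟨fun f Γ => .lam ?_, fun f Γ t ht => ?_⟩
    · exact foldr_cond_typed (fun a => ihα.2 _ _ _ (.var (by simp [lookupVar_append])))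
        (fun a r _ => ihβ.1 _ _) (fun a r h => h) (ihβ.1 _ _) _
    · exact foldr_cond_typed (fun a => ihβ.2 _ _ _ (.app ht (ihα.1 _ _)))
        (fun a r h => h) (fun a r _ => .ff) .tt _

theorem typed_quote {α : Ty} (d : Den α) (Γ : Ctx) : Typed Γ (quote d) α :=
  (typed_code α).1 d Γ

theorem closed_quote {α : Ty} (d : Den α) : Closed (quote d) :=
  closed_of_typed (typed_quote d [])

theorem pure_code {α : Ty} (hα : NmFreeTy α) :
    (∀ d, AN ((code α).1 d) = ∅ ∧ NoGensym ((code α).1 d)) ∧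
    ∀ d t, AN t = ∅ ∧ NoGensym t → AN ((code α).2 d t) = ∅ ∧ NoGensym ((code α).2 d t) := by
  have hbool (b : Bool) : AN (boolVal b) = ∅ ∧ NoGensym (boolVal b) := by
    cases b <;> simp [boolVal, AN, NoGensym]
  have hfold {δ : Type} {c : δ → Tm} {f g : δ → Tm → Tm} {z : Tm}
      (hc : ∀ a, AN (c a) = ∅ ∧ NoGensym (c a))
      (hf : ∀ a r, AN r = ∅ ∧ NoGensym r → AN (f a r) = ∅ ∧ NoGensym (f a r))
      (hg : ∀ a r, AN r = ∅ ∧ NoGensym r → AN (g a r) = ∅ ∧ NoGensym (g a r))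
      (hz : AN z = ∅ ∧ NoGensym z) (l : List δ) :
      AN (l.foldr (fun a r => .cond (c a) (f a r) (g a r)) z) = ∅ ∧
        NoGensym (l.foldr (fun a r => .cond (c a) (f a r) (g a r)) z) := by
    induction l with
    | nil => exact hz
    | cons a l ih =>
      simp only [List.foldr_cons, AN, NoGensym]
      simp [hc a, hf a _ ih, hg a _ ih]
  induction α with
  | unit => simp [code, AN, NoGensym]
  | bool =>
    refine ⟨fun b => hbool b, fun b t ht => ?_⟩
    change Bool at b
    simp [code, AN, NoGensym, hbool, ht]
  | nm => exact hα.elim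
  | prod α β ihα ihβ =>
    obtain ⟨ihα₁, ihα₂⟩ := ihα hα.1
    obtain ⟨ihβ₁, ihβ₂⟩ := ihβ hα.2
    refine ⟨fun d => ?_, fun d t ht => ?_⟩
    · simp [code, AN, NoGensym, ihα₁, ihβ₁]
    · simp [code, AN, NoGensym, ihα₂ d.1 (.fst t) ht, ihβ₂ d.2 (.snd t) ht]
  | arrow α β ihα ihβ =>
    obtain ⟨ihα₁, ihα₂⟩ := ihα hα.1
    obtain ⟨ihβ₁, ihβ₂⟩ := ihβ hα.2
    refine ⟨fun f => ?_, fun f t ht => ?_⟩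
    · exact hfold (fun a => ihα₂ _ _ (by simp [AN, NoGensym])) (fun a r _ => ihβ₁ _)
        (fun a r h => h) (ihβ₁ _) _
    · exact hfold (fun a => ihβ₂ _ _ (by simp [AN, NoGensym, ht, ihα₁])) (fun a r h => h)
        (fun a r _ => by simp [AN, NoGensym]) (by simp [AN, NoGensym]) _

theorem subst_test {α : Ty} (x : ℕ) (W : Tm) :
    ∀ (d : Den α) (t : Tm), subst x W (test d t) = test d (subst x W t) := by
  induction α with
  | unit => intro d t; rfl
  | bool =>
    intro d t
    change Bool at d
    simp [test, code, subst, closed_boolVal _ x W]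
  | nm => intro d t; rfl
  | prod α β ihα ihβ =>
    intro d t
    have h₁ := ihα d.1 (.fst t)
    have h₂ := ihβ d.2 (.snd t)
    simp only [test, subst] at h₁ h₂
    simp [test, code, subst, h₁, h₂]
  | arrow α β _ ihβ =>
    intro f t
    simp only [test, code]
    induction (Finset.univ : Finset (Den α)).toList with
    | nil => rfl
    | cons a l ih =>
      have h := ihβ (f a) (.app t (quote a))
      simp only [subst, closed_quote a x W] at h
      simp only [test, quote] at h
      simp only [List.foldr_cons, subst, ih, h]

open Classical in
theorem realizes_quote_and_test (α : Ty) :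
    (∀ (d : Den α) G, Realizes α d G (quote d)) ∧
    ∀ (d a : Den α) G t, (∀ G', G ⊆ G' → ExpSat (Realizes α d) G' t) →
      ExpSat (Realizes .bool (decide (d = a))) G (test a t) := by
  have htt {G : Finset ℕ} {b : Bool} (hb : b = true) : ExpSat (Realizes .bool b) G .tt :=
    Realizes.expSat (by rw [hb]; rfl)
  have hff {G : Finset ℕ} {b : Bool} (hb : b = false) : ExpSat (Realizes .bool b) G .ff :=
    Realizes.expSat (by rw [hb]; rfl)
  induction α with
  | unit => exact ⟨fun d G => rfl, fun d a G t _ => htt (decide_eq_true rfl)⟩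
  | bool =>
    refine ⟨fun d G => rfl, fun d a G t ht => ?_⟩
    refine ExpSat.cond (ht G subset_rfl) fun G' hG => Realizes.expSat ?_
    by_cases h : d = a
    · rw [decide_eq_true h, h]
      change Bool at a
      cases a <;> rfl
    · rw [decide_eq_false h]
      change Bool at d a
      cases d <;> cases a <;> first | rfl | exact absurd rfl h
  | nm => exact ⟨fun d G => rfl, fun d a G t _ => htt (decide_eq_true rfl)⟩
  | prod α β ihα ihβ =>
    refine ⟨fun d G => ⟨_, _, ihα.1 d.1 G, ihβ.1 d.2 G, rfl⟩, fun d a G t ht => ?_⟩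
    have h₁ : ∀ G', G ⊆ G' → ExpSat (Realizes α d.1) G' (.fst t) := fun G' hG => by
      refine (ht G' hG).bind isFrame_fst ?_
      rintro G'' hG' _ ⟨V₁, V₂, h₁, h₂, rfl⟩
      exact h₁.expSat.of_eval_iff (eval_fst_pair_iff h₁.isValue h₂.isValue)
    have h₂ : ∀ G', G ⊆ G' → ExpSat (Realizes β d.2) G' (.snd t) := fun G' hG => by
      refine (ht G' hG).bind isFrame_snd ?_
      rintro G'' hG' _ ⟨V₁, V₂, h₁, h₂, rfl⟩
      exact h₂.expSat.of_eval_iff (eval_snd_pair_iff h₁.isValue h₂.isValue)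
    refine ExpSat.cond (ihα.2 d.1 a.1 G _ h₁) fun G' hG => ?_
    by_cases h : d.1 = a.1
    · have e : decide (d = a) = decide (d.2 = a.2) :=
        decide_eq_decide.2 ⟨fun e => e ▸ rfl, fun e => Prod.ext h e⟩
      rw [e, if_pos (decide_eq_true h)]
      exact ihβ.2 d.2 a.2 G' _ fun G'' hG' => h₂ G'' (hG.trans hG')
    · rw [if_neg (by simpa using h)]
      exact hff (decide_eq_false fun e => h (e ▸ rfl))
  | arrow α β ihα ihβ =>
    refine ⟨fun f G => ⟨.lam _ _ _, closed_quote f, fun G' hG a A hA => ?_⟩, fun f g G t ht => ?_⟩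
    · refine ExpSat.of_eval_iff ?_ (eval_beta_iff hA.isValue)
      suffices h : ∀ l : List (Den α), a ∈ l → ∀ G'', G' ⊆ G'' →
          ExpSat (Realizes β (f a)) G'' (subst 0 A (l.foldr
            (fun a r => .cond (test a (.var 0)) (quote (f a)) r) (quote (Den.default β)))) from
        h _ (by simp) G' subset_rfl
      intro l
      induction l with
      | nil => intro h; simp at h
      | cons c l ih =>
        intro hl G'' hG'
        simp only [List.foldr_cons, subst, subst_test, if_true, closed_quote (f c) 0 A]
        refine ExpSat.cond (ihα.2 a c G'' A fun H hH =>
          (hA.mono (hG'.trans hH)).expSat) fun H hH => ?_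
        by_cases h : a = c
        · rw [if_pos (decide_eq_true h), h]
          exact (ihβ.1 (f c) H).expSat
        · rw [if_neg (by simpa using h)]
          exact ih ((List.mem_cons.1 hl).resolve_left h) H (hG'.trans hH)
    · suffices h : ∀ l : List (Den α), ∀ G', G ⊆ G' →
          ExpSat (Realizes .bool (decide (∀ a ∈ l, f a = g a))) G' (l.foldr
            (fun a r => .cond (test (g a) (.app t (quote a))) r .ff) .tt) by
        have e : decide (f = g) =
            decide (∀ a ∈ (Finset.univ : Finset (Den α)).toList, f a = g a) :=
          decide_eq_decide.2 ⟨fun e a _ => e ▸ rfl, fun e => funext fun a => e a (by simp)⟩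
        rw [e]
        exact h _ G subset_rfl
      intro l
      induction l with
      | nil => exact fun G' _ => htt (by simp)
      | cons c l ih =>
        intro G' hG
        have happ : ∀ H, G' ⊆ H → ExpSat (Realizes β (f c)) H (.app t (quote c)) := by
          intro H hH
          refine (ht H (hG.trans hH)).bind (isFrame_appL _) fun H' hH' V hV => ?_
          exact hV.2.2 H' subset_rfl c _ (ihα.1 c H')
        refine ExpSat.cond (ihβ.2 (f c) (g c) G' _ happ) fun H hH => ?_
        by_cases h : f c = g c
        · rw [if_pos (decide_eq_true h)]
          simpa [h] using ih H (hG.trans hH)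
        · rw [if_neg (by simpa using h)]
          exact hff (by simp [h])

theorem realizes_quote {α : Ty} (d : Den α) (G : Finset ℕ) : Realizes α d G (quote d) :=
  (realizes_quote_and_test α).1 d G

theorem Realizes.unique {α : Ty} : ∀ {d d' : Den α} {G : Finset ℕ} {V : Tm},
    Realizes α d G V → Realizes α d' G V → d = d' := by
  induction α with
  | unit => intros; rfl
  | bool =>
    intro d d' G V h h'
    change Bool at d d'
    change V = boolVal d at h
    change V = boolVal d' at h'
    cases d <;> cases d' <;> first | rfl | simp_all [boolVal]
  | nm => intros; rfl
  | prod α β ihα ihβ =>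
    rintro d d' G V ⟨V₁, V₂, h₁, h₂, rfl⟩ ⟨V₁', V₂', h₁', h₂', e⟩
    cases e
    exact Prod.ext (ihα h₁ h₁') (ihβ h₂ h₂')
  | arrow α β _ ihβ =>
    intro f f' G V h h'
    funext a
    obtain ⟨⟨G', U, hU⟩, hf⟩ := h.2.2 G subset_rfl a _ (realizes_quote a G)
    obtain ⟨_, hf'⟩ := h'.2.2 G subset_rfl a _ (realizes_quote a G)
    exact ihβ (hf _ _ hU).2 (hf' _ _ hU).2

/-! ### The logical relation at `Nm`-free types -/

theorem ExpRel.of_expSat {S : World → Tm → Tm → Prop} {T : Finset ℕ → Tm → Prop} {w : World}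
    {P Q : Tm} (hP : ExpSat T w.left P) (hQ : ExpSat T w.right Q)
    (hTS : ∀ w' V W, T w'.left V → T w'.right W → S w' V W) : ExpRel S w P Q := by
  refine ⟨hP.1, hQ.1, fun G₁ V G₂ W hV hW => ?_⟩
  obtain ⟨h₁, hV⟩ := hP.2 _ _ hV
  obtain ⟨h₂, hW⟩ := hQ.2 _ _ hW
  exact ⟨w.grow h₁ h₂, w.le_grow h₁ h₂, rfl, rfl, hTS _ _ _ hV hW⟩

/-- At `Nm`-free types, being related means realizing a common semantic element; in
particular the partial bijection is irrelevant. -/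
theorem valRel_iff_realizes {α : Ty} (hα : NmFreeTy α) : ∀ {w : World} {V W : Tm},
    ValRel α w V W ↔ ∃ d, Realizes α d w.left V ∧ Realizes α d w.right W := by
  induction α with
  | unit => exact ⟨fun h => ⟨(), h⟩, fun ⟨_, h⟩ => h⟩
  | bool => exact Iff.rfl
  | nm => exact hα.elim
  | prod α β ihα ihβ =>
    intro w V W
    constructor
    · rintro ⟨V₁, V₂, W₁, W₂, h₁, h₂, rfl, rfl⟩
      obtain ⟨a, hV₁, hW₁⟩ := (ihα hα.1).1 h₁
      obtain ⟨b, hV₂, hW₂⟩ := (ihβ hα.2).1 h₂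
      exact ⟨(a, b), ⟨_, _, hV₁, hV₂, rfl⟩, ⟨_, _, hW₁, hW₂, rfl⟩⟩
    · rintro ⟨d, ⟨V₁, V₂, hV₁, hV₂, rfl⟩, ⟨W₁, W₂, hW₁, hW₂, rfl⟩⟩
      exact ⟨_, _, _, _, (ihα hα.1).2 ⟨_, hV₁, hW₁⟩, (ihβ hα.2).2 ⟨_, hV₂, hW₂⟩, rfl, rfl⟩
  | arrow α β ihα ihβ =>
    intro w V W
    constructor
    · rintro ⟨hV, hW, hcV, hcW, h⟩
      have key (a : Den α) : ∃ b : Den β,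
          (∀ G, w.left ⊆ G → ∀ A, Realizes α a G A → ExpSat (Realizes β b) G (.app V A)) ∧
          (∀ G, w.right ⊆ G → ∀ A, Realizes α a G A → ExpSat (Realizes β b) G (.app W A)) := by
        obtain ⟨⟨G₁, V₀, hV₀⟩, ⟨G₂, W₀, hW₀⟩, h₀⟩ := h w le_rfl _ _
          ((ihα hα.1).2 ⟨a, realizes_quote a _, realizes_quote a _⟩)
        obtain ⟨w₀, _, rfl, rfl, h₀⟩ := h₀ _ _ _ _ hV₀ hW₀
        obtain ⟨b, hb₁, hb₂⟩ := (ihβ hα.2).1 h₀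
        refine ⟨b, fun G hG A hA => ?_, fun G hG A hA => ?_⟩
        · obtain ⟨hex, _, hall⟩ := h _ (w.le_grow hG subset_rfl) A (quote a)
            ((ihα hα.1).2 ⟨a, hA, realizes_quote a _⟩)
          refine ⟨hex, fun G' U hU => ?_⟩
          obtain ⟨w', hw', rfl, hr, hUW⟩ := hall _ _ _ _ hU hW₀
          obtain ⟨b', hb', hb''⟩ := (ihβ hα.2).1 hUW
          rw [hr] at hb''
          exact ⟨hw'.2.1, hb''.unique hb₂ ▸ hb'⟩
        · obtain ⟨_, hex, hall⟩ := h _ (w.le_grow subset_rfl hG) (quote a) A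
            ((ihα hα.1).2 ⟨a, realizes_quote a _, hA⟩)
          refine ⟨hex, fun G' U hU => ?_⟩
          obtain ⟨w', hw', hl, rfl, hUW⟩ := hall _ _ _ _ hV₀ hU
          obtain ⟨b', hb', hb''⟩ := (ihβ hα.2).1 hUW
          rw [hl] at hb'
          exact ⟨hw'.2.2, hb'.unique hb₁ ▸ hb''⟩
      choose f hf₁ hf₂ using key
      exact ⟨f, ⟨hV, hcV, fun G hG a A hA => hf₁ a G hG A hA⟩,
        ⟨hW, hcW, fun G hG a A hA => hf₂ a G hG A hA⟩⟩
    · rintro ⟨f, ⟨hV, hcV, hf₁⟩, ⟨hW, hcW, hf₂⟩⟩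
      refine ⟨hV, hW, hcV, hcW, fun w' hw A B hAB => ?_⟩
      obtain ⟨a, hA, hB⟩ := (ihα hα.1).1 hAB
      exact ExpRel.of_expSat (hf₁ _ hw.2.1 a A hA) (hf₂ _ hw.2.2 a B hB)
        fun _ _ _ h₁ h₂ => (ihβ hα.2).2 ⟨_, h₁, h₂⟩

/-- A closed term of `Nm`-free type has a well-defined semantic value. -/
theorem exists_expSat_realizes {α : Ty} {M : Tm} (hα : NmFreeTy α) (hM : Typed [] M α) :
    ∃ d, ∀ G, AN M ⊆ G → ExpSat (Realizes α d) G M := by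
  obtain ⟨⟨G₀, V, hV⟩, -, h⟩ := expRel_self hM (w := .diag (AN M)) fun r hr => ⟨rfl, hr⟩
  obtain ⟨w, _, _, hr, hVV⟩ := h _ _ _ _ hV hV
  obtain ⟨d, _, hd⟩ := (valRel_iff_realizes hα).1 hVV
  refine ⟨d, fun G hG => ?_⟩
  obtain ⟨hex, -, hall⟩ := expRel_self hM
    (w := (World.diag (AN M)).grow hG subset_rfl) fun r hr => ⟨rfl, hr⟩
  refine ⟨hex, fun G' U hU => ?_⟩
  obtain ⟨w', hw', rfl, hr', hUV⟩ := hall _ _ _ _ hU hV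
  obtain ⟨d', hd₁, hd₂⟩ := (valRel_iff_realizes hα).1 hUV
  rw [hr', ← hr] at hd₂
  exact ⟨hw'.2.1, hd₂.unique hd ▸ hd₁⟩

/-- Closed expressions related in all worlds beyond the identity on `G` are contextually
equivalent. -/
theorem ctxEquiv_of_expRel {G : Finset ℕ} {α : Ty} {M N : Tm} (hM : Closed M) (hN : Closed N)
    (h : ∀ w ≥ World.diag G, ExpRel (ValRel α) w M N) : CtxEquiv G α M N := by
  intro x C b hC hG
  rw [subst_eq_psubst, subst_eq_psubst]
  have hE : EnvRel (.diag G) [] Tm.var Tm.var := by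
    intro y β hy
    simp [lookupVar] at hy
  obtain ⟨⟨G₁, V, hV⟩, ⟨G₂, W, hW⟩, hall⟩ := expRel_psubst hC (tame_var.update hM x)
    (tame_var.update hN x) (hE.update hM hN h) fun r hr => ⟨rfl, hG hr⟩
  have boolVal_inj {a b : Bool} (e : boolVal a = boolVal b) : a = b := by
    cases a <;> cases b <;> simp_all [boolVal]
  constructor
  · rintro ⟨G', hb⟩
    obtain ⟨_, _, _, _, b', e, rfl⟩ := hall _ _ _ _ hb hW
    exact ⟨G₂, boolVal_inj e ▸ hW⟩
  · rintro ⟨G', hb⟩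
    obtain ⟨_, _, _, _, b', rfl, e⟩ := hall _ _ _ _ hV hb
    exact ⟨G₁, boolVal_inj e ▸ hV⟩

end NuCalculus

/-- Every ν-calculus term of an Nm-free type is contextually
equivalent to a pure STLC term (no names, no gensym). -/
theorem nmfree_typed_terms_have_equivalent_stlc_term :
    ∀ (α : Ty) (M : Tm), NmFreeTy α → Typed [] M α →
      ∃ N : Tm, AN N = ∅ ∧ NoGensym N ∧ Typed [] N α ∧
        CtxEquiv (AN M) α M N := by
  intro α M hα hM
  obtain ⟨d, hd⟩ := NuCalculus.exists_expSat_realizes hα hM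
  obtain ⟨hAN, hgensym⟩ := (NuCalculus.pure_code hα).1 d
  refine ⟨NuCalculus.quote d, hAN, hgensym, NuCalculus.typed_quote d [],
    NuCalculus.ctxEquiv_of_expRel (NuCalculus.closed_of_typed hM) (NuCalculus.closed_quote d)
      fun w hw => ?_⟩
  exact NuCalculus.ExpRel.of_expSat (hd _ hw.2.1) (NuCalculus.realizes_quote d _).expSat
    fun _ _ _ h₁ h₂ => (NuCalculus.valRel_iff_realizes hα).2 ⟨d, h₁, h₂⟩
end

section
/- Decidable equality of functions at Nm-free types: for Nm-free types α₁ and α₂ there is a definable ν-calculus (indeed STLC) program EQ^{α₁→α₂} such that for all closed terms M, N of type α₁ → α₂, EQ^{α₁→α₂}(M,N) evaluates to true iff M and N are contextually equivalent, where EQ is defined by applying M and N to each member of the finite complete list of values of type α₁ and comparing the results recursively. -/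
/-! Typing contexts and free variables. -/

theorem lookupVar_append_singleton (Γ : Ctx) (x y : ℕ) (α : Ty) :
    lookupVar (Γ ++ [(x, α)]) y = if y = x then some α else lookupVar Γ y := by
  by_cases h : y = x
  · subst h; simp [lookupVar]
  · have h' : (x == y) = false := by simpa using fun e => h e.symm
    simp [lookupVar, h, h']

theorem Typed.lookupVar_ne_none {Γ : Ctx} {M : Tm} {τ : Ty} (h : Typed Γ M τ) :
    ∀ x ∈ FV M, lookupVar Γ x ≠ none := by
  induction h with
  | var h => intro x hx; simp only [FV, Finset.mem_singleton] at hx; subst hx; simp [h]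
  | lam _ ih =>
    intro y hy
    simp only [FV, Finset.mem_sdiff, Finset.mem_singleton] at hy
    simpa [lookupVar_append_singleton, hy.2] using ih y hy.1
  | letin _ _ ih₁ ih₂ =>
    intro y hy
    simp only [FV, Finset.mem_union, Finset.mem_sdiff, Finset.mem_singleton] at hy
    rcases hy with hy | hy
    · exact ih₁ y hy
    · simpa [lookupVar_append_singleton, hy.2] using ih₂ y hy.1
  | _ => simp_all [FV, or_imp]

theorem Typed.congr_ctx {Γ : Ctx} {M : Tm} {τ : Ty} (h : Typed Γ M τ) :
    ∀ Δ : Ctx, (∀ x ∈ FV M, lookupVar Δ x = lookupVar Γ x) → Typed Δ M τ := by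
  induction h with
  | var h => intro Δ hΔ; exact .var (by rw [hΔ _ (by simp [FV]), h])
  | unit => intro Δ _; exact .unit
  | tt => intro Δ _; exact .tt
  | ff => intro Δ _; exact .ff
  | name r => intro Δ _; exact .name r
  | gensym => intro Δ _; exact .gensym
  | lam _ ih =>
    intro Δ hΔ
    refine .lam (ih _ fun y hy => ?_)
    rw [lookupVar_append_singleton, lookupVar_append_singleton]
    split_ifs with hyx
    · rfl
    · exact hΔ y (by simp [FV, hy, hyx])
  | app _ _ ih₁ ih₂ =>
    intro Δ hΔ
    exact .app (ih₁ _ fun x hx => hΔ x (by simp [FV, hx]))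
      (ih₂ _ fun x hx => hΔ x (by simp [FV, hx]))
  | pair _ _ ih₁ ih₂ =>
    intro Δ hΔ
    exact .pair (ih₁ _ fun x hx => hΔ x (by simp [FV, hx]))
      (ih₂ _ fun x hx => hΔ x (by simp [FV, hx]))
  | fst _ ih => intro Δ hΔ; exact .fst (ih _ fun x hx => hΔ x (by simp [FV, hx]))
  | snd _ ih => intro Δ hΔ; exact .snd (ih _ fun x hx => hΔ x (by simp [FV, hx]))
  | cond _ _ _ ih₁ ih₂ ih₃ =>
    intro Δ hΔ
    exact .cond (ih₁ _ fun x hx => hΔ x (by simp [FV, hx]))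
      (ih₂ _ fun x hx => hΔ x (by simp [FV, hx])) (ih₃ _ fun x hx => hΔ x (by simp [FV, hx]))
  | letin _ _ ih₁ ih₂ =>
    intro Δ hΔ
    refine .letin (ih₁ _ fun x hx => hΔ x (by simp [FV, hx])) (ih₂ _ fun y hy => ?_)
    rw [lookupVar_append_singleton, lookupVar_append_singleton]
    split_ifs with hyx
    · rfl
    · exact hΔ y (by simp [FV, hy, hyx])
  | eqNm _ _ ih₁ ih₂ =>
    intro Δ hΔ
    exact .eqNm (ih₁ _ fun x hx => hΔ x (by simp [FV, hx]))
      (ih₂ _ fun x hx => hΔ x (by simp [FV, hx]))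
  | eqBool _ _ ih₁ ih₂ =>
    intro Δ hΔ
    exact .eqBool (ih₁ _ fun x hx => hΔ x (by simp [FV, hx]))
      (ih₂ _ fun x hx => hΔ x (by simp [FV, hx]))

theorem Typed.FV_eq_empty {M : Tm} {τ : Ty} (h : Typed [] M τ) : FV M = ∅ :=
  Finset.eq_empty_of_forall_notMem fun x hx => h.lookupVar_ne_none x hx rfl

theorem Typed.weaken {M : Tm} {τ : Ty} (h : Typed [] M τ) (Γ : Ctx) : Typed Γ M τ :=
  h.congr_ctx Γ (by simp [h.FV_eq_empty])

theorem subst_eq_self {x : ℕ} {V : Tm} {M : Tm} (h : x ∉ FV M) : subst x V M = M := by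
  induction M with
  | var y => simp only [FV, Finset.mem_singleton] at h; simp [subst, Ne.symm h]
  | lam y α M ih =>
    simp only [FV, Finset.mem_sdiff, Finset.mem_singleton, not_and, not_not] at h
    by_cases hy : y = x
    · simp [subst, hy]
    · simp [subst, hy, ih fun hx => hy (h hx).symm]
  | letin y M N ihM ihN =>
    simp only [FV, Finset.mem_union, Finset.mem_sdiff, Finset.mem_singleton, not_or, not_and,
      not_not] at h
    by_cases hy : y = x
    · simp [subst, hy, ihM h.1]
    · simp [subst, hy, ihM h.1, ihN fun hx => hy (h.2 hx).symm]
  | _ => simp_all [FV, subst]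

theorem subst_of_closed {x : ℕ} {V M : Tm} (h : FV M = ∅) : subst x V M = M :=
  subst_eq_self (by simp [h])

/-! Parallel substitution. -/

/-- Simultaneous substitution of `γ x` for every free variable `x`, without renaming. -/
def psubst (γ : ℕ → Tm) : Tm → Tm
  | .var y => γ y
  | .lam y α M => .lam y α (psubst (Function.update γ y (.var y)) M)
  | .app M N => .app (psubst γ M) (psubst γ N)
  | .pair M N => .pair (psubst γ M) (psubst γ N)
  | .fst M => .fst (psubst γ M)
  | .snd M => .snd (psubst γ M)
  | .cond M N₁ N₂ => .cond (psubst γ M) (psubst γ N₁) (psubst γ N₂)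
  | .letin y M N => .letin y (psubst γ M) (psubst (Function.update γ y (.var y)) N)
  | .eq M N => .eq (psubst γ M) (psubst γ N)
  | t => t

theorem psubst_var (M : Tm) : psubst Tm.var M = M := by
  induction M <;> simp_all [psubst]

theorem subst_psubst {x : ℕ} {W : Tm} (M : Tm) :
    ∀ {γ : ℕ → Tm}, γ x = .var x → (∀ y, y ≠ x → x ∉ FV (γ y)) →
      subst x W (psubst γ M) = psubst (Function.update γ x W) M := by
  have key : ∀ {γ : ℕ → Tm} {y : ℕ}, y ≠ x → γ x = .var x → (∀ y, y ≠ x → x ∉ FV (γ y)) →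
      Function.update γ y (.var y) x = .var x ∧
        ∀ z, z ≠ x → x ∉ FV (Function.update γ y (.var y) z) := by
    intro γ y hy hx h
    refine ⟨by rw [Function.update_of_ne (Ne.symm hy), hx], fun z hz => ?_⟩
    by_cases hzy : z = y
    · subst hzy; simpa [FV] using Ne.symm hz
    · rw [Function.update_of_ne hzy]; exact h z hz
  induction M with
  | var y =>
    intro γ hx h
    by_cases hy : y = x
    · subst hy; simp [psubst, hx, subst]
    · simp only [psubst, Function.update_of_ne hy]
      exact subst_eq_self (h y hy)
  | lam y α M ih =>
    intro γ hx h
    by_cases hy : y = x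
    · subst hy; simp [psubst, subst]
    · obtain ⟨h₁, h₂⟩ := key hy hx h
      simp [psubst, subst, hy, ih h₁ h₂, Function.update_comm hy]
  | letin y M N ihM ihN =>
    intro γ hx h
    by_cases hy : y = x
    · subst hy; simp [psubst, subst, ihM hx h]
    · obtain ⟨h₁, h₂⟩ := key hy hx h
      simp [psubst, subst, hy, ihM hx h, ihN h₁ h₂, Function.update_comm hy]
  | _ => clear key; intro γ hx h; simp_all [psubst, subst]

theorem subst_eq_psubst (x : ℕ) (W M : Tm) :
    subst x W M = psubst (Function.update Tm.var x W) M := by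
  conv_lhs => rw [← psubst_var M]
  exact subst_psubst M rfl (by simp [FV, eq_comm])

theorem FV_psubst_subset (M : Tm) : ∀ {γ : ℕ → Tm} {S : Finset ℕ},
    (∀ x ∈ FV M, FV (γ x) ⊆ S) → FV (psubst γ M) ⊆ S := by
  have key : ∀ {γ : ℕ → Tm} {S : Finset ℕ} {y : ℕ} {M : Tm},
      (∀ x ∈ FV M \ {y}, FV (γ x) ⊆ S) →
        ∀ x ∈ FV M, FV (Function.update γ y (.var y) x) ⊆ insert y S := by
    intro γ S y M h x hx
    by_cases hxy : x = y
    · subst hxy; simp [FV]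
    · rw [Function.update_of_ne hxy]
      exact (h x (by simp [hx, hxy])).trans (Finset.subset_insert _ _)
  induction M with
  | var y => intro γ S h; exact h y (by simp [FV])
  | lam y α M ih =>
    intro γ S h
    simp only [psubst, FV]
    exact sdiff_le_iff.2 (ih (key h))
  | letin y M N ihM ihN =>
    intro γ S h
    have h₁ := ihM fun x hx => h x (by simp only [FV, Finset.mem_union]; exact Or.inl hx)
    have h₂ := ihN (key (M := N) fun x hx => h x (by
      simp only [FV, Finset.mem_union]; exact Or.inr hx))
    simp only [psubst, FV]
    exact Finset.union_subset h₁ (sdiff_le_iff.2 h₂)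
  | _ => clear key; intro γ S h; simp_all [psubst, FV, Finset.union_subset_iff, or_imp]

theorem FV_subst_subset {x : ℕ} {V : Tm} (hV : FV V = ∅) (M : Tm) :
    FV (subst x V M) ⊆ FV M \ {x} := by
  rw [subst_eq_psubst]
  refine FV_psubst_subset M fun y hy => ?_
  by_cases hyx : y = x
  · subst hyx; simp [hV]
  · rw [Function.update_of_ne hyx]
    simp [FV, hy, hyx]

/-- Every variable is left alone or replaced by a closed term. -/
def ClosedSubst (γ : ℕ → Tm) : Prop := ∀ y, γ y = .var y ∨ FV (γ y) = ∅

theorem ClosedSubst.var : ClosedSubst Tm.var := fun _ => Or.inl rfl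

theorem ClosedSubst.update {γ : ℕ → Tm} (h : ClosedSubst γ) (x : ℕ) {W : Tm} (hW : FV W = ∅) :
    ClosedSubst (Function.update γ x W) := by
  intro y
  by_cases hy : y = x
  · subst hy; simp [hW]
  · simpa [Function.update_of_ne hy] using h y

theorem ClosedSubst.subst_psubst {γ : ℕ → Tm} (h : ClosedSubst γ) (x : ℕ) (W M : Tm) :
    subst x W (psubst (Function.update γ x (.var x)) M) = psubst (Function.update γ x W) M := by
  rw [_root_.subst_psubst M (by simp) fun y hy => ?_, Function.update_idem]
  rw [Function.update_of_ne hy]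
  rcases h y with h | h
  · simpa [h, FV] using Ne.symm hy
  · simp [h]

/-! Evaluation as a state-passing computation. -/

/-- A nondeterministic computation from a set of names to a set of names and a term. -/
abbrev Cmp := Finset ℕ → Finset ℕ → Tm → Prop

/-- The computation performed by evaluating a term. -/
def run (M : Tm) : Cmp := fun s t U => Eval s M t U

/-- The computation returning `V` without generating names. -/
def Cmp.ret (V : Tm) : Cmp := fun s t U => t = s ∧ U = V

/-- Sequential composition of computations. -/
def Cmp.bind (c : Cmp) (k : Tm → Cmp) : Cmp := fun s t U => ∃ s' V, c s s' V ∧ k V s' t U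

theorem Eval.isValue {s t : Finset ℕ} {M V : Tm} (h : Eval s M t V) : IsValue V := by
  induction h with
  | val h => exact h
  | app => assumption
  | gensym => exact .name _
  | pair _ _ h₁ h₂ => exact .pair h₁ h₂
  | fst _ ih => cases ih; assumption
  | snd _ ih => cases ih; assumption
  | condT => assumption
  | condF => assumption
  | letin => assumption
  | eqT => exact .tt
  | eqF => exact .ff
  | eqBoolT => exact .tt
  | eqBoolF => exact .ff

theorem IsValue.eval_eq {V : Tm} (hV : IsValue V) :
    ∀ {s t : Finset ℕ} {U : Tm}, Eval s V t U → t = s ∧ U = V := by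
  induction hV with
  | pair _ _ ih₁ ih₂ =>
    intro s t U h
    cases h with
    | val => exact ⟨rfl, rfl⟩
    | pair h₁ h₂ =>
      obtain ⟨rfl, rfl⟩ := ih₁ h₁
      obtain ⟨rfl, rfl⟩ := ih₂ h₂
      exact ⟨rfl, rfl⟩
  | _ => intro s t U h; cases h; exact ⟨rfl, rfl⟩

theorem IsValue.run_eq {V : Tm} (hV : IsValue V) : run V = Cmp.ret V := by
  ext s t U
  refine ⟨fun h => hV.eval_eq h, ?_⟩
  rintro ⟨rfl, rfl⟩
  exact .val hV

theorem run_app (M N : Tm) :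
    run (.app M N) = (run M).bind fun V => (run N).bind fun W => run (.app V W) := by
  ext s t U
  constructor
  · intro h
    cases h with
    | val h => cases h
    | app h₁ h₂ hW h₃ => exact ⟨_, _, h₁, _, _, h₂, .app (.val h₁.isValue) (.val hW) hW h₃⟩
    | gensym r h₁ h₂ hr => exact ⟨_, _, h₁, _, _, h₂, .gensym r (.val .gensym) (.val .unit) hr⟩
  · rintro ⟨s₁, V, h₁, s₂, W, h₂, h⟩
    cases h with
    | val h => cases h
    | app h₁' h₂' hW h₃ =>
      obtain ⟨rfl, rfl⟩ := h₁.isValue.eval_eq h₁'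
      obtain ⟨rfl, rfl⟩ := h₂.isValue.eval_eq h₂'
      exact .app h₁ h₂ hW h₃
    | gensym r h₁' h₂' hr =>
      obtain ⟨rfl, rfl⟩ := h₁.isValue.eval_eq h₁'
      obtain ⟨rfl, rfl⟩ := h₂.isValue.eval_eq h₂'
      exact .gensym r h₁ h₂ hr

theorem run_app_lam (x : ℕ) (α : Ty) (B : Tm) {W : Tm} (hW : IsValue W) :
    run (.app (.lam x α B) W) = run (subst x W B) := by
  ext s t U
  constructor
  · intro h
    cases h with
    | val h => cases h
    | app h₁ h₂ _ h₃ =>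
      obtain ⟨rfl, h⟩ := (IsValue.lam x α B).eval_eq h₁
      obtain ⟨rfl, rfl⟩ := hW.eval_eq h₂
      cases h
      exact h₃
    | gensym r h₁ => cases h₁
  · intro h
    exact .app (.val (.lam _ _ _)) (.val hW) hW h

theorem run_app_gensym :
    run (.app .gensym .unit) = fun s t U => ∃ r, r ∉ s ∧ t = insert r s ∧ U = .name r := by
  ext s t U
  constructor
  · intro h
    cases h with
    | val h => cases h
    | app h₁ => cases h₁
    | gensym r h₁ h₂ hr =>
      obtain ⟨rfl, -⟩ := IsValue.gensym.eval_eq h₁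
      obtain ⟨rfl, -⟩ := IsValue.unit.eval_eq h₂
      exact ⟨r, hr, rfl, rfl⟩
  · rintro ⟨r, hr, rfl, rfl⟩
    exact .gensym r (.val .gensym) (.val .unit) hr

theorem run_pair (M N : Tm) :
    run (.pair M N) = (run M).bind fun V => (run N).bind fun W => Cmp.ret (.pair V W) := by
  ext s t U
  constructor
  · intro h
    cases h with
    | val h =>
      cases h with
      | pair h₁ h₂ => exact ⟨_, _, .val h₁, _, _, .val h₂, rfl, rfl⟩
    | pair h₁ h₂ => exact ⟨_, _, h₁, _, _, h₂, rfl, rfl⟩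
  · rintro ⟨s₁, V, h₁, s₂, W, h₂, rfl, rfl⟩
    exact .pair h₁ h₂

theorem run_fst (M : Tm) :
    run (.fst M) = (run M).bind fun V s t U => t = s ∧ ∃ W, V = .pair U W := by
  ext s t U
  constructor
  · intro h
    cases h with
    | val h => cases h
    | fst h => exact ⟨_, _, h, rfl, _, rfl⟩
  · rintro ⟨s₁, V, h₁, rfl, W, rfl⟩
    exact .fst h₁

theorem run_snd (M : Tm) :
    run (.snd M) = (run M).bind fun V s t U => t = s ∧ ∃ W, V = .pair W U := by
  ext s t U
  constructor
  · intro h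
    cases h with
    | val h => cases h
    | snd h => exact ⟨_, _, h, rfl, _, rfl⟩
  · rintro ⟨s₁, V, h₁, rfl, W, rfl⟩
    exact .snd h₁

theorem fst_pair_eq_ret (V W : Tm) :
    (fun s t U => t = s ∧ ∃ W', Tm.pair V W = .pair U W' : Cmp) = Cmp.ret V := by
  ext s t U
  simp [Cmp.ret, eq_comm]

theorem snd_pair_eq_ret (V W : Tm) :
    (fun s t U => t = s ∧ ∃ V', Tm.pair V W = .pair V' U : Cmp) = Cmp.ret W := by
  ext s t U
  simp [Cmp.ret, eq_comm]

theorem run_cond (M N₁ N₂ : Tm) :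
    run (.cond M N₁ N₂) =
      (run M).bind fun V s t U => V = .tt ∧ run N₁ s t U ∨ V = .ff ∧ run N₂ s t U := by
  ext s t U
  constructor
  · intro h
    cases h with
    | val h => cases h
    | condT h₁ h₂ => exact ⟨_, _, h₁, .inl ⟨rfl, h₂⟩⟩
    | condF h₁ h₂ => exact ⟨_, _, h₁, .inr ⟨rfl, h₂⟩⟩
  · rintro ⟨s₁, V, h₁, ⟨rfl, h₂⟩ | ⟨rfl, h₂⟩⟩
    · exact .condT h₁ h₂
    · exact .condF h₁ h₂

theorem run_letin (x : ℕ) (M N : Tm) :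
    run (.letin x M N) = (run M).bind fun V => run (subst x V N) := by
  ext s t U
  constructor
  · intro h
    cases h with
    | val h => cases h
    | letin h₁ _ h₂ => exact ⟨_, _, h₁, h₂⟩
  · rintro ⟨s₁, V, h₁, h₂⟩
    exact .letin h₁ h₁.isValue h₂

/-- The outcome of comparing two names or two booleans. -/
def EqOutcome (V W U : Tm) : Prop :=
  (∃ a b : ℕ, V = .name a ∧ W = .name b ∧ U = boolVal (decide (a = b))) ∨
    ∃ a b : Bool, V = boolVal a ∧ W = boolVal b ∧ U = boolVal (decide (a = b))

theorem run_eq (M N : Tm) :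
    run (.eq M N) =
      (run M).bind fun V => (run N).bind fun W s t U => t = s ∧ EqOutcome V W U := by
  ext s t U
  constructor
  · intro h
    cases h with
    | val h => cases h
    | @eqT _ _ _ _ _ r h₁ h₂ =>
      exact ⟨_, _, h₁, _, _, h₂, rfl, .inl ⟨r, r, rfl, rfl, by rw [decide_eq_true rfl]; rfl⟩⟩
    | @eqF _ _ _ _ _ r r' h₁ h₂ hne =>
      exact ⟨_, _, h₁, _, _, h₂, rfl, .inl ⟨r, r', rfl, rfl, by rw [decide_eq_false hne]; rfl⟩⟩
    | eqBoolT h₁ h₂ hb =>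
      refine ⟨_, _, h₁, _, _, h₂, rfl, .inr ?_⟩
      rcases hb with rfl | rfl
      · exact ⟨true, true, rfl, rfl, rfl⟩
      · exact ⟨false, false, rfl, rfl, rfl⟩
    | eqBoolF h₁ h₂ hb =>
      refine ⟨_, _, h₁, _, _, h₂, rfl, .inr ?_⟩
      rcases hb with ⟨rfl, rfl⟩ | ⟨rfl, rfl⟩
      · exact ⟨true, false, rfl, rfl, rfl⟩
      · exact ⟨false, true, rfl, rfl, rfl⟩
  · rintro ⟨s₁, V, h₁, s₂, W, h₂, rfl, ⟨a, b, rfl, rfl, rfl⟩ | ⟨a, b, rfl, rfl, rfl⟩⟩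
    · by_cases hab : a = b
      · subst hab
        rw [decide_eq_true rfl]
        exact .eqT h₁ h₂
      · rw [decide_eq_false hab]
        exact .eqF h₁ h₂ hab
    · cases a <;> cases b
      · exact .eqBoolT h₁ h₂ (.inr rfl)
      · exact .eqBoolF h₁ h₂ (.inr ⟨rfl, rfl⟩)
      · exact .eqBoolF h₁ h₂ (.inl ⟨rfl, rfl⟩)
      · exact .eqBoolT h₁ h₂ (.inl rfl)

theorem boolVal_injective : Function.Injective boolVal := by
  intro a b h
  cases a <;> cases b <;> simp_all [boolVal]

theorem isValue_boolVal (b : Bool) : IsValue (boolVal b) := by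
  cases b
  · exact .ff
  · exact .tt

theorem FV_boolVal (b : Bool) : FV (boolVal b) = ∅ := by
  cases b <;> rfl

theorem eqOutcome_boolVal_iff {a b : Bool} {U : Tm} :
    EqOutcome (boolVal a) (boolVal b) U ↔ U = boolVal (decide (a = b)) := by
  constructor
  · rintro (⟨a', b', h, -⟩ | ⟨a', b', h, h', rfl⟩)
    · cases a <;> cases h
    · rw [boolVal_injective h, boolVal_injective h']
  · rintro rfl; exact .inr ⟨a, b, rfl, rfl, rfl⟩

theorem eqOutcome_name_iff {a b : ℕ} {U : Tm} :
    EqOutcome (.name a) (.name b) U ↔ U = boolVal (decide (a = b)) := by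
  constructor
  · rintro (⟨a', b', h, h', rfl⟩ | ⟨a', b', h, -⟩)
    · cases h; cases h'; rfl
    · cases a' <;> cases h
  · rintro rfl; exact .inl ⟨a, b, rfl, rfl, rfl⟩

/-! The binary logical relation over partial bijections of names. -/

/-- Two sets of names with a partial bijection between them. -/
structure NameWorld where
  left : Finset ℕ
  right : Finset ℕ
  rel : ℕ → ℕ → Prop
  mem : ∀ {a b}, rel a b → a ∈ left ∧ b ∈ right
  eq_iff : ∀ {a b a' b'}, rel a b → rel a' b' → (a = a' ↔ b = b')

namespace NameWorld

instance : Preorder NameWorld where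
  le w w' := w.left ⊆ w'.left ∧ w.right ⊆ w'.right ∧ ∀ a b, w.rel a b → w'.rel a b
  le_refl _ := ⟨subset_rfl, subset_rfl, fun _ _ h => h⟩
  le_trans _ _ _ h h' :=
    ⟨h.1.trans h'.1, h.2.1.trans h'.2.1, fun a b hab => h'.2.2 a b (h.2.2 a b hab)⟩

/-- Add a pair of related fresh names. -/
def extend (w : NameWorld) (r r' : ℕ) (hr : r ∉ w.left) (hr' : r' ∉ w.right) : NameWorld where
  left := insert r w.left
  right := insert r' w.right
  rel a b := w.rel a b ∨ a = r ∧ b = r'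
  mem := by
    rintro a b (h | ⟨rfl, rfl⟩)
    · exact ⟨Finset.mem_insert_of_mem (w.mem h).1, Finset.mem_insert_of_mem (w.mem h).2⟩
    · exact ⟨Finset.mem_insert_self _ _, Finset.mem_insert_self _ _⟩
  eq_iff := by
    rintro a b a' b' (h | ⟨rfl, rfl⟩) (h' | ⟨rfl, rfl⟩)
    · exact w.eq_iff h h'
    · exact iff_of_false (fun e => hr (e ▸ (w.mem h).1)) fun e => hr' (e ▸ (w.mem h).2)
    · exact iff_of_false (fun e => hr (e ▸ (w.mem h').1)) fun e => hr' (e ▸ (w.mem h').2)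
    · simp

/-- Enlarge the two sets of names without relating any new names. -/
def grow (w : NameWorld) {s t : Finset ℕ} (hs : w.left ⊆ s) (ht : w.right ⊆ t) : NameWorld where
  left := s
  right := t
  rel := w.rel
  mem h := ⟨hs (w.mem h).1, ht (w.mem h).2⟩
  eq_iff := w.eq_iff

theorem le_grow (w : NameWorld) {s t : Finset ℕ} (hs : w.left ⊆ s) (ht : w.right ⊆ t) :
    w ≤ w.grow hs ht := ⟨hs, ht, fun _ _ h => h⟩

/-- The identity on the names of `G`. -/
def diag (G : Finset ℕ) : NameWorld where
  left := G
  right := G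
  rel a b := a ∈ G ∧ a = b
  mem := by rintro a b ⟨h, rfl⟩; exact ⟨h, h⟩
  eq_iff := by rintro a b a' b' ⟨-, rfl⟩ ⟨-, rfl⟩; rfl

end NameWorld

/-- Both computations terminate, and any two of their results are related in a later world. -/
def CmpRel (P : NameWorld → Tm → Tm → Prop) (w : NameWorld) (c c' : Cmp) : Prop :=
  (∃ t U, c w.left t U) ∧ (∃ t U, c' w.right t U) ∧
    ∀ t U t' U', c w.left t U → c' w.right t' U' →
      ∃ w', w ≤ w' ∧ w'.left = t ∧ w'.right = t' ∧ P w' U U'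

theorem CmpRel.ret {P : NameWorld → Tm → Tm → Prop} {w : NameWorld} {V V' : Tm} (h : P w V V') :
    CmpRel P w (Cmp.ret V) (Cmp.ret V') := by
  refine ⟨⟨_, _, rfl, rfl⟩, ⟨_, _, rfl, rfl⟩, ?_⟩
  rintro _ _ _ _ ⟨rfl, rfl⟩ ⟨rfl, rfl⟩
  exact ⟨w, le_rfl, rfl, rfl, h⟩

theorem CmpRel.bind {P Q : NameWorld → Tm → Tm → Prop} {w : NameWorld} {c c' : Cmp}
    {k k' : Tm → Cmp} (h : CmpRel P w c c')
    (hk : ∀ w', w ≤ w' → ∀ V V', P w' V V' → CmpRel Q w' (k V) (k' V')) :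
    CmpRel Q w (c.bind k) (c'.bind k') := by
  obtain ⟨⟨s, V, hV⟩, ⟨s', V', hV'⟩, hP⟩ := h
  refine ⟨?_, ?_, ?_⟩
  · obtain ⟨w', hw, rfl, rfl, hVV⟩ := hP _ _ _ _ hV hV'
    obtain ⟨⟨t, U, hU⟩, -, -⟩ := hk w' hw _ _ hVV
    exact ⟨t, U, _, _, hV, hU⟩
  · obtain ⟨w', hw, rfl, rfl, hVV⟩ := hP _ _ _ _ hV hV'
    obtain ⟨-, ⟨t, U, hU⟩, -⟩ := hk w' hw _ _ hVV
    exact ⟨t, U, _, _, hV', hU⟩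
  · rintro t U t' U' ⟨s, V, hV, hU⟩ ⟨s', V', hV', hU'⟩
    obtain ⟨w', hw, rfl, rfl, hVV⟩ := hP _ _ _ _ hV hV'
    obtain ⟨w'', hw', h⟩ := (hk w' hw _ _ hVV).2.2 _ _ _ _ hU hU'
    exact ⟨w'', hw.trans hw', h⟩

/-- The logical relation on closed values. -/
def ValRel : Ty → NameWorld → Tm → Tm → Prop
  | .unit => fun _ V V' => V = .unit ∧ V' = .unit
  | .bool => fun _ V V' => ∃ b, V = boolVal b ∧ V' = boolVal b
  | .nm => fun w V V' => ∃ a b, w.rel a b ∧ V = .name a ∧ V' = .name b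
  | .prod α β => fun w V V' => ∃ V₁ V₂ V₁' V₂', ValRel α w V₁ V₁' ∧ ValRel β w V₂ V₂' ∧
      V = .pair V₁ V₂ ∧ V' = .pair V₁' V₂'
  | .arrow α β => fun w V V' => (IsValue V ∧ FV V = ∅) ∧ (IsValue V' ∧ FV V' = ∅) ∧
      ∀ w', w ≤ w' → ∀ W W', ValRel α w' W W' →
        CmpRel (ValRel β) w' (run (.app V W)) (run (.app V' W'))

theorem ValRel.mono {τ : Ty} {w w' : NameWorld} (hw : w ≤ w') :
    ∀ {V V' : Tm}, ValRel τ w V V' → ValRel τ w' V V' := by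
  induction τ with
  | unit => exact id
  | bool => exact id
  | nm => rintro V V' ⟨a, b, h, hV⟩; exact ⟨a, b, hw.2.2 _ _ h, hV⟩
  | prod α β ihα ihβ =>
    rintro V V' ⟨V₁, V₂, V₁', V₂', h₁, h₂, h⟩
    exact ⟨V₁, V₂, V₁', V₂', ihα h₁, ihβ h₂, h⟩
  | arrow α β => rintro V V' ⟨h, h', H⟩; exact ⟨h, h', fun w'' hw' => H w'' (hw.trans hw')⟩

theorem ValRel.isValue_closed {τ : Ty} {w : NameWorld} : ∀ {V V' : Tm}, ValRel τ w V V' →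
    (IsValue V ∧ FV V = ∅) ∧ IsValue V' ∧ FV V' = ∅ := by
  induction τ with
  | unit => rintro V V' ⟨rfl, rfl⟩; exact ⟨⟨.unit, rfl⟩, .unit, rfl⟩
  | bool =>
    rintro V V' ⟨b, rfl, rfl⟩
    exact ⟨⟨isValue_boolVal b, FV_boolVal b⟩, isValue_boolVal b, FV_boolVal b⟩
  | nm => rintro V V' ⟨a, b, -, rfl, rfl⟩; exact ⟨⟨.name _, rfl⟩, .name _, rfl⟩
  | prod α β ihα ihβ =>
    rintro V V' ⟨V₁, V₂, V₁', V₂', h₁, h₂, rfl, rfl⟩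
    obtain ⟨⟨h₁, e₁⟩, h₁', e₁'⟩ := ihα h₁
    obtain ⟨⟨h₂, e₂⟩, h₂', e₂'⟩ := ihβ h₂
    exact ⟨⟨.pair h₁ h₂, by simp [FV, e₁, e₂]⟩, .pair h₁' h₂', by simp [FV, e₁', e₂']⟩
  | arrow α β => rintro V V' ⟨h, h', -⟩; exact ⟨h, h'⟩

/-- Substitutions of closed terms that compute related values. -/
def SubstRel (Γ : Ctx) (w : NameWorld) (γ γ' : ℕ → Tm) : Prop :=
  ∀ x τ, lookupVar Γ x = some τ → (FV (γ x) = ∅ ∧ FV (γ' x) = ∅) ∧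
    ∀ w', w ≤ w' → CmpRel (ValRel τ) w' (run (γ x)) (run (γ' x))

theorem SubstRel.mono {Γ : Ctx} {w w' : NameWorld} {γ γ' : ℕ → Tm} (h : SubstRel Γ w γ γ')
    (hw : w ≤ w') : SubstRel Γ w' γ γ' :=
  fun x τ hx => ⟨(h x τ hx).1, fun w'' hw' => (h x τ hx).2 w'' (hw.trans hw')⟩

theorem SubstRel.update {Γ : Ctx} {w : NameWorld} {γ γ' : ℕ → Tm} (h : SubstRel Γ w γ γ')
    (x : ℕ) {α : Ty} {W W' : Tm} (hW : ValRel α w W W') :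
    SubstRel (Γ ++ [(x, α)]) w (Function.update γ x W) (Function.update γ' x W') := by
  intro y τ hy
  rw [lookupVar_append_singleton] at hy
  by_cases hyx : y = x
  · subst hyx
    simp only [if_true, Option.some.injEq] at hy
    subst hy
    obtain ⟨⟨v, e⟩, v', e'⟩ := hW.isValue_closed
    simp only [Function.update_self]
    refine ⟨⟨e, e'⟩, fun w' hw => ?_⟩
    rw [v.run_eq, v'.run_eq]
    exact .ret (hW.mono hw)
  · rw [if_neg hyx] at hy
    simpa only [Function.update_of_ne hyx] using h y τ hy

theorem SubstRel.closed {Γ : Ctx} {w : NameWorld} {γ γ' : ℕ → Tm} (h : SubstRel Γ w γ γ')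
    {M : Tm} {τ : Ty} (hM : Typed Γ M τ) : FV (psubst γ M) = ∅ ∧ FV (psubst γ' M) = ∅ := by
  have key : ∀ x ∈ FV M, FV (γ x) = ∅ ∧ FV (γ' x) = ∅ := fun x hx => by
    obtain ⟨σ, hσ⟩ := Option.ne_none_iff_exists'.1 (hM.lookupVar_ne_none x hx)
    exact (h x σ hσ).1
  constructor
  · exact Finset.subset_empty.1 (FV_psubst_subset M fun x hx => (key x hx).1.subset)
  · exact Finset.subset_empty.1 (FV_psubst_subset M fun x hx => (key x hx).2.subset)

theorem cmpRel_eqOutcome {w : NameWorld} {V W V' W' : Tm} {b : Bool}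
    (h : ∀ U, EqOutcome V W U ↔ U = boolVal b) (h' : ∀ U, EqOutcome V' W' U ↔ U = boolVal b) :
    CmpRel (ValRel .bool) w (fun s t U => t = s ∧ EqOutcome V W U)
      (fun s t U => t = s ∧ EqOutcome V' W' U) := by
  simp only [h, h']
  exact CmpRel.ret (P := ValRel .bool) ⟨b, rfl, rfl⟩

/-- The fundamental property of the logical relation. -/
theorem Typed.cmpRel {Γ : Ctx} {M : Tm} {τ : Ty} (hM : Typed Γ M τ) :
    ∀ {w : NameWorld} {γ γ' : ℕ → Tm}, ClosedSubst γ → ClosedSubst γ' →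
      (∀ a ∈ AN M, w.rel a a) → SubstRel Γ w γ γ' →
      CmpRel (ValRel τ) w (run (psubst γ M)) (run (psubst γ' M)) := by
  induction hM with
  | var h => intro w γ γ' _ _ _ hγ; exact (hγ _ _ h).2 w le_rfl
  | unit =>
    intro w γ γ' _ _ _ _
    simp only [psubst, IsValue.unit.run_eq]
    exact .ret ⟨rfl, rfl⟩
  | tt =>
    intro w γ γ' _ _ _ _
    simp only [psubst, IsValue.tt.run_eq]
    exact .ret ⟨true, rfl, rfl⟩
  | ff =>
    intro w γ γ' _ _ _ _
    simp only [psubst, IsValue.ff.run_eq]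
    exact .ret ⟨false, rfl, rfl⟩
  | name r =>
    intro w γ γ' _ _ hn _
    simp only [psubst, (IsValue.name r).run_eq]
    exact .ret ⟨r, r, hn r (by simp [AN]), rfl, rfl⟩
  | gensym =>
    intro w γ γ' _ _ _ _
    simp only [psubst, IsValue.gensym.run_eq]
    refine .ret ⟨⟨.gensym, rfl⟩, ⟨.gensym, rfl⟩, ?_⟩
    rintro w' - W W' ⟨rfl, rfl⟩
    rw [run_app_gensym]
    obtain ⟨r, hr⟩ := Infinite.exists_notMem_finset w'.left
    obtain ⟨r', hr'⟩ := Infinite.exists_notMem_finset w'.right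
    refine ⟨⟨_, _, r, hr, rfl, rfl⟩, ⟨_, _, r', hr', rfl, rfl⟩, ?_⟩
    rintro _ _ _ _ ⟨a, ha, rfl, rfl⟩ ⟨b, hb, rfl, rfl⟩
    exact ⟨w'.extend a b ha hb, ⟨Finset.subset_insert _ _, Finset.subset_insert _ _,
      fun _ _ => Or.inl⟩, rfl, rfl, a, b, Or.inr ⟨rfl, rfl⟩, rfl, rfl⟩
  | @lam Γ x α β M hM ih =>
    intro w γ γ' hc hc' hn hγ
    have hcl := hγ.closed (Typed.lam hM)
    simp only [psubst] at hcl ⊢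
    rw [(IsValue.lam _ _ _).run_eq, (IsValue.lam _ _ _).run_eq]
    refine .ret ⟨⟨.lam _ _ _, hcl.1⟩, ⟨.lam _ _ _, hcl.2⟩, fun w' hw W W' hW => ?_⟩
    obtain ⟨⟨v, e⟩, v', e'⟩ := hW.isValue_closed
    rw [run_app_lam _ _ _ v, run_app_lam _ _ _ v', hc.subst_psubst, hc'.subst_psubst]
    exact ih (hc.update x e) (hc'.update x e') (fun a ha => hw.2.2 _ _ (hn a ha))
      ((hγ.mono hw).update x hW)
  | app _ _ ih₁ ih₂ =>
    intro w γ γ' hc hc' hn hγ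
    simp only [psubst, run_app (psubst _ _)]
    refine (ih₁ hc hc' (fun a ha => hn a (by simp [AN, ha])) hγ).bind fun w₁ hw₁ V V' hV => ?_
    refine (ih₂ hc hc' (fun a ha => hw₁.2.2 _ _ (hn a (by simp [AN, ha])))
      (hγ.mono hw₁)).bind fun w₂ hw₂ W W' hW => ?_
    exact hV.2.2 w₂ hw₂ W W' hW
  | pair _ _ ih₁ ih₂ =>
    intro w γ γ' hc hc' hn hγ
    simp only [psubst, run_pair]
    refine (ih₁ hc hc' (fun a ha => hn a (by simp [AN, ha])) hγ).bind fun w₁ hw₁ V V' hV => ?_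
    refine (ih₂ hc hc' (fun a ha => hw₁.2.2 _ _ (hn a (by simp [AN, ha])))
      (hγ.mono hw₁)).bind fun w₂ hw₂ W W' hW => ?_
    exact .ret ⟨V, W, V', W', hV.mono hw₂, hW, rfl, rfl⟩
  | fst _ ih =>
    intro w γ γ' hc hc' hn hγ
    simp only [psubst, run_fst]
    refine (ih hc hc' hn hγ).bind ?_
    rintro w' - _ _ ⟨V, W, V', W', hV, hW, rfl, rfl⟩
    rw [fst_pair_eq_ret, fst_pair_eq_ret]
    exact .ret hV
  | snd _ ih =>
    intro w γ γ' hc hc' hn hγ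
    simp only [psubst, run_snd]
    refine (ih hc hc' hn hγ).bind ?_
    rintro w' - _ _ ⟨V, W, V', W', hV, hW, rfl, rfl⟩
    rw [snd_pair_eq_ret, snd_pair_eq_ret]
    exact .ret hW
  | cond _ _ _ ih ih₁ ih₂ =>
    intro w γ γ' hc hc' hn hγ
    simp only [psubst, run_cond]
    refine (ih hc hc' (fun a ha => hn a (by simp [AN, ha])) hγ).bind ?_
    rintro w₁ hw₁ _ _ ⟨b, rfl, rfl⟩
    cases b
    · simpa [boolVal] using ih₂ hc hc' (fun a ha => hw₁.2.2 _ _ (hn a (by simp [AN, ha])))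
        (hγ.mono hw₁)
    · simpa [boolVal] using ih₁ hc hc' (fun a ha => hw₁.2.2 _ _ (hn a (by simp [AN, ha])))
        (hγ.mono hw₁)
  | @letin Γ x M N α β _ _ ih₁ ih₂ =>
    intro w γ γ' hc hc' hn hγ
    simp only [psubst, run_letin]
    refine (ih₁ hc hc' (fun a ha => hn a (by simp [AN, ha])) hγ).bind fun w₁ hw₁ V V' hV => ?_
    obtain ⟨⟨-, e⟩, -, e'⟩ := hV.isValue_closed
    rw [hc.subst_psubst, hc'.subst_psubst]
    exact ih₂ (hc.update x e) (hc'.update x e')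
      (fun a ha => hw₁.2.2 _ _ (hn a (by simp [AN, ha]))) ((hγ.mono hw₁).update x hV)
  | eqNm _ _ ih₁ ih₂ =>
    intro w γ γ' hc hc' hn hγ
    simp only [psubst, run_eq]
    refine (ih₁ hc hc' (fun a ha => hn a (by simp [AN, ha])) hγ).bind fun w₁ hw₁ V V' hV => ?_
    refine (ih₂ hc hc' (fun a ha => hw₁.2.2 _ _ (hn a (by simp [AN, ha])))
      (hγ.mono hw₁)).bind fun w₂ hw₂ W W' hW => ?_
    obtain ⟨a, a', ha, rfl, rfl⟩ := hV.mono hw₂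
    obtain ⟨b, b', hb, rfl, rfl⟩ := hW
    exact cmpRel_eqOutcome (fun _ => eqOutcome_name_iff)
      fun _ => by rw [eqOutcome_name_iff, decide_eq_decide.2 (w₂.eq_iff ha hb)]
  | eqBool _ _ ih₁ ih₂ =>
    intro w γ γ' hc hc' hn hγ
    simp only [psubst, run_eq]
    refine (ih₁ hc hc' (fun a ha => hn a (by simp [AN, ha])) hγ).bind fun w₁ hw₁ V V' hV => ?_
    refine (ih₂ hc hc' (fun a ha => hw₁.2.2 _ _ (hn a (by simp [AN, ha])))
      (hγ.mono hw₁)).bind fun w₂ hw₂ W W' hW => ?_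
    obtain ⟨a, rfl, rfl⟩ := hV
    obtain ⟨b, rfl, rfl⟩ := hW
    exact cmpRel_eqOutcome (fun _ => eqOutcome_boolVal_iff) fun _ => eqOutcome_boolVal_iff

/-! Denotations and realizers. -/

/-- The full set-theoretic type hierarchy; the name type is interpreted trivially. -/
def Den : Ty → Type
  | .unit => Unit
  | .bool => Bool
  | .nm => Unit
  | .prod α β => Den α × Den β
  | .arrow α β => Den α → Den β

theorem Den.finite_nonempty (τ : Ty) : Finite (Den τ) ∧ Nonempty (Den τ) := by
  induction τ with
  | unit => exact ⟨inferInstanceAs (Finite Unit), ⟨()⟩⟩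
  | bool => exact ⟨inferInstanceAs (Finite Bool), ⟨true⟩⟩
  | nm => exact ⟨inferInstanceAs (Finite Unit), ⟨()⟩⟩
  | prod α β ihα ihβ =>
    obtain ⟨_, _⟩ := ihα
    obtain ⟨_, _⟩ := ihβ
    exact ⟨inferInstanceAs (Finite (Den α × Den β)), inferInstanceAs (Nonempty (Den α × Den β))⟩
  | arrow α β ihα ihβ =>
    obtain ⟨_, _⟩ := ihα
    obtain ⟨_, _⟩ := ihβ
    exact ⟨inferInstanceAs (Finite (Den α → Den β)), inferInstanceAs (Nonempty (Den α → Den β))⟩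

theorem Den.exists_list (τ : Ty) : ∃ l : List (Den τ), ∀ d, d ∈ l := by
  obtain ⟨_, _⟩ := Den.finite_nonempty τ
  obtain ⟨l, -, h⟩ := Finite.exists_univ_list (Den τ)
  exact ⟨l, h⟩

/-- The computation terminates from `s`, and all its results satisfy `P`. -/
def CmpPred (P : Finset ℕ → Tm → Prop) (s : Finset ℕ) (c : Cmp) : Prop :=
  (∃ t U, c s t U) ∧ ∀ t U, c s t U → s ⊆ t ∧ P t U

theorem CmpPred.ret {P : Finset ℕ → Tm → Prop} {s : Finset ℕ} {V : Tm} (h : P s V) :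
    CmpPred P s (Cmp.ret V) := by
  refine ⟨⟨_, _, rfl, rfl⟩, ?_⟩
  rintro _ _ ⟨rfl, rfl⟩
  exact ⟨subset_rfl, h⟩

theorem CmpPred.bind {P Q : Finset ℕ → Tm → Prop} {s : Finset ℕ} {c : Cmp} {k : Tm → Cmp}
    (h : CmpPred P s c) (hk : ∀ t, s ⊆ t → ∀ V, P t V → CmpPred Q t (k V)) :
    CmpPred Q s (c.bind k) := by
  obtain ⟨⟨t, V, hV⟩, hP⟩ := h
  constructor
  · obtain ⟨ht, hVP⟩ := hP _ _ hV
    obtain ⟨⟨t', U, hU⟩, -⟩ := hk t ht V hVP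
    exact ⟨t', U, t, V, hV, hU⟩
  · rintro t' U ⟨t, V, hV, hU⟩
    obtain ⟨ht, hVP⟩ := hP _ _ hV
    obtain ⟨ht', hUQ⟩ := (hk t ht V hVP).2 _ _ hU
    exact ⟨ht.trans ht', hUQ⟩

/-- `Realizes τ s V d`: in every state extending `s`, the closed value `V` behaves as `d`. -/
def Realizes : (τ : Ty) → Finset ℕ → Tm → Den τ → Prop
  | .unit => fun _ V _ => V = .unit
  | .bool => fun _ V b => V = boolVal b
  | .nm => fun _ _ _ => False
  | .prod α β => fun s V d => ∃ V₁ V₂, Realizes α s V₁ d.1 ∧ Realizes β s V₂ d.2 ∧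
      V = .pair V₁ V₂
  | .arrow α β => fun s V f => (IsValue V ∧ FV V = ∅) ∧
      ∀ s', s ⊆ s' → ∀ W e, Realizes α s' W e →
        CmpPred (fun t U => Realizes β t U (f e)) s' (run (.app V W))

theorem Realizes.mono {τ : Ty} {s s' : Finset ℕ} (hs : s ⊆ s') :
    ∀ {V : Tm} {d : Den τ}, Realizes τ s V d → Realizes τ s' V d := by
  induction τ with
  | unit => exact id
  | bool => exact id
  | nm => exact id
  | prod α β ihα ihβ =>
    rintro V d ⟨V₁, V₂, h₁, h₂, h⟩
    exact ⟨V₁, V₂, ihα h₁, ihβ h₂, h⟩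
  | arrow α β => rintro V d ⟨h, H⟩; exact ⟨h, fun s'' hs' => H s'' (hs.trans hs')⟩

theorem Realizes.isValue_closed {τ : Ty} {s : Finset ℕ} :
    ∀ {V : Tm} {d : Den τ}, Realizes τ s V d → IsValue V ∧ FV V = ∅ := by
  induction τ with
  | unit => rintro V d rfl; exact ⟨.unit, rfl⟩
  | bool => rintro V d rfl; exact ⟨isValue_boolVal d, FV_boolVal d⟩
  | nm => rintro V d ⟨⟩
  | prod α β ihα ihβ =>
    rintro V d ⟨V₁, V₂, h₁, h₂, rfl⟩
    obtain ⟨h₁, e₁⟩ := ihα h₁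
    obtain ⟨h₂, e₂⟩ := ihβ h₂
    exact ⟨.pair h₁ h₂, by simp [FV, e₁, e₂]⟩
  | arrow α β => rintro V d ⟨h, -⟩; exact h

/-- Every result of the computation realizes `d`. -/
abbrev CmpRealizes (τ : Ty) (s : Finset ℕ) (c : Cmp) (d : Den τ) : Prop :=
  CmpPred (fun t U => Realizes τ t U d) s c

theorem cmpRealizes_app {α β : Ty} {s : Finset ℕ} {M N : Tm} {f : Den (.arrow α β)} {e : Den α}
    (hM : CmpRealizes (.arrow α β) s (run M) f) (hN : ∀ t, s ⊆ t → CmpRealizes α t (run N) e) :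
    CmpRealizes β s (run (.app M N)) (f e) := by
  rw [run_app]
  exact hM.bind fun t ht V hV => (hN t ht).bind fun t' ht' W hW => hV.2 t' ht' W e hW

/-! Denotations definable by programs without names. -/

/-- A closed name-free program without `gensym` realizes `d` in every state. -/
def Definable (τ : Ty) (d : Den τ) : Prop :=
  ∃ D : Tm, Typed [] D τ ∧ AN D = ∅ ∧ NoGensym D ∧ ∀ s, CmpRealizes τ s (run D) d

/-- The name-free programs with free variables `0 : α` and `1 : β` realizing `f`. -/
def BinDefinable (α β γ : Ty) (f : Den α → Den β → Den γ) : Prop :=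
  ∃ B : Tm, Typed [(0, α), (1, β)] B γ ∧ AN B = ∅ ∧ NoGensym B ∧
    ∀ s V W a b, Realizes α s V a → Realizes β s W b →
      CmpRealizes γ s (run (subst 1 W (subst 0 V B))) (f a b)

theorem Definable.app {α β : Ty} {f : Den (.arrow α β)} {e : Den α}
    (hf : Definable (.arrow α β) f) (he : Definable α e) : Definable β (f e) := by
  obtain ⟨F, tF, nF, gF, hF⟩ := hf
  obtain ⟨D, tD, nD, gD, hD⟩ := he
  exact ⟨.app F D, .app tF tD, by simp [AN, nF, nD], ⟨gF, gD⟩,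
    fun s => cmpRealizes_app (hF s) fun t _ => hD t⟩

namespace BinDefinable

variable {α β γ δ : Ty}

theorem congr {f g : Den α → Den β → Den γ} (hf : BinDefinable α β γ f)
    (h : ∀ a b, f a b = g a b) : BinDefinable α β γ g := by
  have hfg : f = g := funext fun a => funext fun b => h a b
  rwa [← hfg]

theorem of_definable {d : Den γ} (h : Definable γ d) : BinDefinable α β γ fun _ _ => d := by
  obtain ⟨D, tD, nD, gD, hD⟩ := h
  refine ⟨D, tD.weaken _, nD, gD, fun s V W a b _ _ => ?_⟩
  rw [subst_of_closed tD.FV_eq_empty, subst_of_closed tD.FV_eq_empty]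
  exact hD s

theorem left : BinDefinable α β α fun a _ => a := by
  refine ⟨.var 0, .var rfl, rfl, trivial, fun s V W a b hV _ => ?_⟩
  obtain ⟨v, e⟩ := hV.isValue_closed
  simp only [subst, if_true, subst_of_closed e, v.run_eq]
  exact .ret hV

theorem right : BinDefinable α β β fun _ b => b := by
  refine ⟨.var 1, .var rfl, rfl, trivial, fun s V W a b _ hW => ?_⟩
  obtain ⟨v, e⟩ := hW.isValue_closed
  simp only [subst, if_true, one_ne_zero, if_false, v.run_eq]
  exact .ret hW

theorem app {f : Den α → Den β → Den (.arrow γ δ)} {g : Den α → Den β → Den γ}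
    (hf : BinDefinable α β (.arrow γ δ) f) (hg : BinDefinable α β γ g) :
    BinDefinable α β δ fun a b => f a b (g a b) := by
  obtain ⟨F, tF, nF, gF, hF⟩ := hf
  obtain ⟨D, tD, nD, gD, hD⟩ := hg
  exact ⟨.app F D, .app tF tD, by simp [AN, nF, nD], ⟨gF, gD⟩, fun s V W a b hV hW =>
    cmpRealizes_app (hF s V W a b hV hW) fun t ht => hD t V W a b (hV.mono ht) (hW.mono ht)⟩

theorem pair {f : Den α → Den β → Den γ} {g : Den α → Den β → Den δ}
    (hf : BinDefinable α β γ f) (hg : BinDefinable α β δ g) :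
    BinDefinable α β (.prod γ δ) fun a b => (f a b, g a b) := by
  obtain ⟨F, tF, nF, gF, hF⟩ := hf
  obtain ⟨D, tD, nD, gD, hD⟩ := hg
  refine ⟨.pair F D, .pair tF tD, by simp [AN, nF, nD], ⟨gF, gD⟩, fun s V W a b hV hW => ?_⟩
  simp only [subst, run_pair]
  refine (hF s V W a b hV hW).bind fun t ht V₁ h₁ => ?_
  refine (hD t V W a b (hV.mono ht) (hW.mono ht)).bind fun t' ht' V₂ h₂ => ?_
  exact .ret ⟨V₁, V₂, h₁.mono ht', h₂, rfl⟩

theorem fst {f : Den α → Den β → Den (.prod γ δ)} (hf : BinDefinable α β (.prod γ δ) f) :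
    BinDefinable α β γ fun a b => (f a b).1 := by
  obtain ⟨F, tF, nF, gF, hF⟩ := hf
  refine ⟨.fst F, .fst tF, nF, gF, fun s V W a b hV hW => ?_⟩
  simp only [subst, run_fst]
  refine (hF s V W a b hV hW).bind ?_
  rintro t - _ ⟨V₁, V₂, h₁, h₂, rfl⟩
  rw [fst_pair_eq_ret]
  exact .ret h₁

theorem snd {f : Den α → Den β → Den (.prod γ δ)} (hf : BinDefinable α β (.prod γ δ) f) :
    BinDefinable α β δ fun a b => (f a b).2 := by
  obtain ⟨F, tF, nF, gF, hF⟩ := hf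
  refine ⟨.snd F, .snd tF, nF, gF, fun s V W a b hV hW => ?_⟩
  simp only [subst, run_snd]
  refine (hF s V W a b hV hW).bind ?_
  rintro t - _ ⟨V₁, V₂, h₁, h₂, rfl⟩
  rw [snd_pair_eq_ret]
  exact .ret h₂

theorem ite {p : Den α → Den β → Bool} {f g : Den α → Den β → Den γ}
    (hp : BinDefinable α β .bool p) (hf : BinDefinable α β γ f) (hg : BinDefinable α β γ g) :
    BinDefinable α β γ fun a b => if p a b then f a b else g a b := by
  obtain ⟨P, tP, nP, gP, hP⟩ := hp
  obtain ⟨F, tF, nF, gF, hF⟩ := hf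
  obtain ⟨D, tD, nD, gD, hD⟩ := hg
  refine ⟨.cond P F D, .cond tP tF tD, by simp [AN, nP, nF, nD], ⟨gP, gF, gD⟩,
    fun s V W a b hV hW => ?_⟩
  simp only [subst, run_cond]
  refine (hP s V W a b hV hW).bind ?_
  rintro t ht _ rfl
  cases p a b
  · simpa [boolVal] using hD t V W a b (hV.mono ht) (hW.mono ht)
  · simpa [boolVal] using hF t V W a b (hV.mono ht) (hW.mono ht)

theorem beq {p q : Den α → Den β → Bool}
    (hp : BinDefinable α β .bool p) (hq : BinDefinable α β .bool q) :
    BinDefinable α β .bool fun a b => decide (p a b = q a b) := by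
  obtain ⟨P, tP, nP, gP, hP⟩ := hp
  obtain ⟨Q, tQ, nQ, gQ, hQ⟩ := hq
  refine ⟨.eq P Q, .eqBool tP tQ, by simp [AN, nP, nQ], ⟨gP, gQ⟩, fun s V W a b hV hW => ?_⟩
  simp only [subst, run_eq]
  refine (hP s V W a b hV hW).bind ?_
  rintro t ht _ rfl
  refine (hQ t V W a b (hV.mono ht) (hW.mono ht)).bind ?_
  rintro t' ht' _ rfl
  simp only [eqOutcome_boolVal_iff]
  exact CmpPred.ret (P := fun t U => Realizes .bool t U _) rfl

theorem definable {f : Den α → Den β → Den γ} (hf : BinDefinable α β γ f) :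
    Definable (.arrow α (.arrow β γ)) f := by
  obtain ⟨B, tB, nB, gB, hB⟩ := hf
  have tL : Typed [] (.lam 0 α (.lam 1 β B)) (.arrow α (.arrow β γ)) := .lam (.lam tB)
  refine ⟨_, tL, nB, gB, fun s => ?_⟩
  rw [(IsValue.lam _ _ _).run_eq]
  refine .ret ⟨⟨.lam _ _ _, tL.FV_eq_empty⟩, fun s₁ _ V a hV => ?_⟩
  obtain ⟨v, e⟩ := hV.isValue_closed
  have hcl : FV (subst 0 V (.lam 1 β B)) = ∅ :=
    Finset.subset_empty.1 ((FV_subst_subset e _).trans tL.FV_eq_empty.subset)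
  simp only [subst, one_ne_zero, if_false] at hcl
  rw [run_app_lam _ _ _ v]
  simp only [subst, one_ne_zero, if_false]
  rw [(IsValue.lam _ _ _).run_eq]
  refine .ret ⟨⟨.lam _ _ _, hcl⟩, fun s₂ hs₂ W b hW => ?_⟩
  rw [run_app_lam _ _ _ hW.isValue_closed.1]
  exact hB s₂ V W a b (hV.mono hs₂) hW

end BinDefinable

theorem definable_unit : Definable .unit () := by
  refine ⟨.unit, .unit, rfl, trivial, fun s => ?_⟩
  rw [IsValue.unit.run_eq]
  exact .ret rfl

theorem definable_bool (b : Bool) : Definable .bool b := by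
  refine ⟨boolVal b, ?_, ?_, ?_, fun s => ?_⟩
  · cases b
    · exact .ff
    · exact .tt
  · cases b <;> rfl
  · cases b <;> trivial
  · rw [(isValue_boolVal b).run_eq]
    exact .ret rfl

open Classical in
/-- Equality is definable at every name-free type, and so is every element of such a type. -/
theorem definable_of_nmFree {τ : Ty} (hτ : NmFreeTy τ) :
    Definable (.arrow τ (.arrow τ .bool)) (fun a b => decide (a = b)) ∧
      ∀ d : Den τ, Definable τ d := by
  induction τ with
  | unit =>
    refine ⟨?_, fun _ => definable_unit⟩
    refine ((BinDefinable.of_definable (definable_bool true)).congr fun a b => ?_).definable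
    exact (decide_eq_true (show a = b from rfl)).symm
  | bool =>
    refine ⟨?_, definable_bool⟩
    refine ((BinDefinable.beq .left .right).congr fun a b => ?_).definable
    exact decide_eq_decide.2 Iff.rfl
  | nm => exact hτ.elim
  | prod α β ihα ihβ =>
    obtain ⟨qα, dα⟩ := ihα hτ.1
    obtain ⟨qβ, dβ⟩ := ihβ hτ.2
    constructor
    · refine ((BinDefinable.ite
        (.app (.app (.of_definable qα) (.fst .left)) (.fst .right))
        (.app (.app (.of_definable qβ) (.snd .left)) (.snd .right))
        (.of_definable (definable_bool false))).congr fun p q => ?_).definable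
      obtain ⟨a, b⟩ := p
      obtain ⟨a', b'⟩ := q
      by_cases h : a = a'
      · subst h
        simp only [decide_true, ↓reduceIte]
        exact decide_eq_decide.2 ⟨congrArg (Prod.mk a), fun h' => (Prod.mk.inj h').2⟩
      · simp only [h, decide_false, Bool.false_eq_true, ↓reduceIte]
        symm
        apply decide_eq_false
        exact fun h' => h (Prod.mk.inj h').1
    · rintro ⟨a, b⟩
      have := (BinDefinable.pair .left .right : BinDefinable α β (.prod α β) _).definable
      exact (this.app (dα a)).app (dβ b)
  | arrow α β ihα ihβ =>
    obtain ⟨qα, dα⟩ := ihα hτ.1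
    obtain ⟨qβ, dβ⟩ := ihβ hτ.2
    obtain ⟨l, hl⟩ := Den.exists_list α
    constructor
    · have key : ∀ l : List (Den α), BinDefinable (.arrow α β) (.arrow α β) .bool
          fun f g => decide (∀ e ∈ l, f e = g e) := by
        intro l
        induction l with
        | nil =>
          exact (BinDefinable.of_definable (definable_bool true)).congr fun f g => by simp; rfl
        | cons e l ih =>
          refine (BinDefinable.ite
            (.app (.app (.of_definable qβ) (.app .left (.of_definable (dα e))))
              (.app .right (.of_definable (dα e)))) ih
            (.of_definable (definable_bool false))).congr fun f g => ?_
          by_cases h : f e = g e <;> simp [h] <;> rfl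
      refine ((key l).congr fun f g => ?_).definable
      exact decide_eq_decide.2 ⟨fun h => funext fun e => h e (hl e), fun h e _ => congrFun h e⟩
    · intro d
      have key : ∀ l : List (Den α), BinDefinable β α β
          fun b a => if a ∈ l then d a else b := by
        intro l
        induction l with
        | nil => exact BinDefinable.left.congr fun b a => by simp
        | cons e l ih =>
          refine (BinDefinable.ite
            (.app (.app (.of_definable qα) .right) (.of_definable (dα e)))
            (.of_definable (dβ (d e))) ih).congr fun b a => ?_
          by_cases h : a = e <;> simp [h]
      obtain ⟨-, ⟨b⟩⟩ := Den.finite_nonempty β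
      have hd : (fun a => if a ∈ l then d a else b) = d := funext fun a => by simp [hl a]
      exact hd ▸ (key l).definable.app (dβ b)

/-! Agreement of the logical relation with realizability at name-free types. -/

theorem Realizes.unique {τ : Ty} (hτ : NmFreeTy τ) {s : Finset ℕ} :
    ∀ {V : Tm} {d d' : Den τ}, Realizes τ s V d → Realizes τ s V d' → d = d' := by
  induction τ generalizing s with
  | unit => intros; rfl
  | bool => intro V d d' h h'; exact boolVal_injective (h.symm.trans h')
  | nm => exact hτ.elim
  | prod α β ihα ihβ =>
    rintro V d d' ⟨V₁, V₂, h₁, h₂, rfl⟩ ⟨V₁', V₂', h₁', h₂', h⟩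
    cases h
    exact Prod.ext (ihα hτ.1 h₁ h₁') (ihβ hτ.2 h₂ h₂')
  | arrow α β ihα ihβ =>
    intro V f f' h h'
    funext e
    obtain ⟨D, -, -, -, hD⟩ := (definable_of_nmFree hτ.1).2 e
    obtain ⟨⟨t, W, hW⟩, H⟩ := hD s
    obtain ⟨hst, hWe⟩ := H t W hW
    obtain ⟨⟨t', U, hU⟩, hf⟩ := h.2 t hst W e hWe
    exact ihβ hτ.2 (hf t' U hU).2 ((h'.2 t hst W e hWe).2 t' U hU).2

theorem valRel_iff_realizes {τ : Ty} (hτ : NmFreeTy τ) : ∀ {w : NameWorld} {V V' : Tm},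
    ValRel τ w V V' ↔ ∃ d, Realizes τ w.left V d ∧ Realizes τ w.right V' d := by
  induction τ with
  | unit =>
    intro w V V'
    exact ⟨fun h => ⟨(), h.1, h.2⟩, fun ⟨_, h, h'⟩ => ⟨h, h'⟩⟩
  | bool => intro w V V'; exact Iff.rfl
  | nm => exact hτ.elim
  | prod α β ihα ihβ =>
    intro w V V'
    constructor
    · rintro ⟨V₁, V₂, V₁', V₂', h₁, h₂, rfl, rfl⟩
      obtain ⟨a, ha, ha'⟩ := (ihα hτ.1).1 h₁
      obtain ⟨b, hb, hb'⟩ := (ihβ hτ.2).1 h₂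
      exact ⟨(a, b), ⟨_, _, ha, hb, rfl⟩, ⟨_, _, ha', hb', rfl⟩⟩
    · rintro ⟨d, ⟨V₁, V₂, h₁, h₂, rfl⟩, ⟨V₁', V₂', h₁', h₂', rfl⟩⟩
      exact ⟨V₁, V₂, V₁', V₂', (ihα hτ.1).2 ⟨_, h₁, h₁'⟩, (ihβ hτ.2).2 ⟨_, h₂, h₂'⟩, rfl, rfl⟩
  | arrow α β ihα ihβ =>
    intro w V V'
    constructor
    · rintro ⟨hV, hV', H⟩
      have key : ∀ e : Den α, ∃ b : Den β,
          (∀ s, w.left ⊆ s → ∀ W, Realizes α s W e → CmpRealizes β s (run (.app V W)) b) ∧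
          ∀ s, w.right ⊆ s → ∀ W, Realizes α s W e → CmpRealizes β s (run (.app V' W)) b := by
        intro e
        obtain ⟨D, -, -, -, hD⟩ := (definable_of_nmFree hτ.1).2 e
        obtain ⟨⟨tl, Wl, hWl⟩, Hl⟩ := hD w.left
        obtain ⟨hl, hWl⟩ := Hl _ _ hWl
        obtain ⟨⟨tr, Wr, hWr⟩, Hr⟩ := hD w.right
        obtain ⟨hr, hWr⟩ := Hr _ _ hWr
        have step : ∀ {s s' : Finset ℕ} (hs : w.left ⊆ s) (hs' : w.right ⊆ s') {W W' : Tm},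
            Realizes α s W e → Realizes α s' W' e →
            CmpRel (ValRel β) (w.grow hs hs') (run (.app V W)) (run (.app V' W')) :=
          fun hs hs' W W' hW hW' => H _ (w.le_grow hs hs') W W' ((ihα hτ.1).2 ⟨e, hW, hW'⟩)
        obtain ⟨⟨ul, Ul, hUl⟩, ⟨ur, Ur, hUr⟩, H₀⟩ := step hl hr hWl hWr
        obtain ⟨w₀, -, rfl, rfl, h₀⟩ := H₀ _ _ _ _ hUl hUr
        obtain ⟨b, hbl, hbr⟩ := (ihβ hτ.2).1 h₀
        refine ⟨b, fun s hs W hW => ?_, fun s hs W hW => ?_⟩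
        · obtain ⟨hex, -, H₁⟩ := step hs hr hW hWr
          refine ⟨hex, fun t U hU => ?_⟩
          obtain ⟨w₁, hw₁, rfl, h₂, h₁⟩ := H₁ _ _ _ _ hU hUr
          obtain ⟨b', hb', hb''⟩ := (ihβ hτ.2).1 h₁
          rw [h₂] at hb''
          rw [hbr.unique hτ.2 hb'']
          exact ⟨hw₁.1, hb'⟩
        · obtain ⟨-, hex, H₁⟩ := step hl hs hWl hW
          refine ⟨hex, fun t U hU => ?_⟩
          obtain ⟨w₁, hw₁, h₂, rfl, h₁⟩ := H₁ _ _ _ _ hUl hU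
          obtain ⟨b', hb', hb''⟩ := (ihβ hτ.2).1 h₁
          rw [h₂] at hb'
          rw [hbl.unique hτ.2 hb']
          exact ⟨hw₁.2.1, hb''⟩
      choose f hf using key
      exact ⟨f, ⟨hV, fun s hs W e => (hf e).1 s hs W⟩, ⟨hV', fun s hs W e => (hf e).2 s hs W⟩⟩
    · rintro ⟨f, ⟨hV, H⟩, ⟨hV', H'⟩⟩
      refine ⟨hV, hV', fun w' hw W W' hW => ?_⟩
      obtain ⟨e, he, he'⟩ := (ihα hτ.1).1 hW
      obtain ⟨hex, h⟩ := H _ hw.1 W e he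
      obtain ⟨hex', h'⟩ := H' _ hw.2.1 W' e he'
      refine ⟨hex, hex', fun t U t' U' hU hU' => ?_⟩
      obtain ⟨ht, hU⟩ := h _ _ hU
      obtain ⟨ht', hU'⟩ := h' _ _ hU'
      exact ⟨w'.grow ht ht', w'.le_grow ht ht', rfl, rfl, (ihβ hτ.2).2 ⟨_, hU, hU'⟩⟩

theorem CmpRealizes.cmpRel {τ : Ty} (hτ : NmFreeTy τ) {w : NameWorld} {c c' : Cmp} {d : Den τ}
    (h : CmpRealizes τ w.left c d) (h' : CmpRealizes τ w.right c' d) :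
    CmpRel (ValRel τ) w c c' := by
  refine ⟨h.1, h'.1, fun t U t' U' hU hU' => ?_⟩
  obtain ⟨ht, hU⟩ := h.2 _ _ hU
  obtain ⟨ht', hU'⟩ := h'.2 _ _ hU'
  exact ⟨w.grow ht ht', w.le_grow ht ht', rfl, rfl, (valRel_iff_realizes hτ).2 ⟨d, hU, hU'⟩⟩

/-- Closed terms of name-free type have a denotation. -/
theorem Typed.exists_cmpRealizes {τ : Ty} (hτ : NmFreeTy τ) {M : Tm} (hM : Typed [] M τ)
    {G : Finset ℕ} (hG : AN M ⊆ G) : ∃ d, ∀ s, G ⊆ s → CmpRealizes τ s (run M) d := by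
  have step : ∀ {s : Finset ℕ} (hs : G ⊆ s), CmpRel (ValRel τ)
      ((NameWorld.diag G).grow hs subset_rfl) (run M) (run M) := fun hs => by
    have := hM.cmpRel (w := (NameWorld.diag G).grow hs subset_rfl) .var .var
      (fun a ha => ⟨hG ha, rfl⟩) fun x σ hx => by cases hx
    rwa [psubst_var] at this
  obtain ⟨-, ⟨t₀, U₀, hU₀⟩, H₀⟩ := step (subset_refl G)
  obtain ⟨w₀, -, -, rfl, h₀⟩ := H₀ _ _ _ _ hU₀ hU₀
  obtain ⟨d, -, hd⟩ := (valRel_iff_realizes hτ).1 h₀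
  refine ⟨d, fun s hs => ?_⟩
  obtain ⟨hex, -, H⟩ := step hs
  refine ⟨hex, fun t U hU => ?_⟩
  obtain ⟨w, hw, rfl, h', h⟩ := H _ _ _ _ hU hU₀
  obtain ⟨d', hd₁, hd₂⟩ := (valRel_iff_realizes hτ).1 h
  rw [h'] at hd₂
  rw [hd.unique hτ hd₂]
  exact ⟨hw.1, hd₁⟩

/-- Closed terms with the same denotation are contextually equivalent. -/
theorem ctxEquiv_of_cmpRealizes {τ : Ty} (hτ : NmFreeTy τ) {M N : Tm} (hM : Typed [] M τ)
    (hN : Typed [] N τ) {G : Finset ℕ} {d : Den τ} (hdM : ∀ s, G ⊆ s → CmpRealizes τ s (run M) d)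
    (hdN : ∀ s, G ⊆ s → CmpRealizes τ s (run N) d) : CtxEquiv G τ M N := by
  intro h C b hC hG
  have key := hC.cmpRel (w := NameWorld.diag G) (ClosedSubst.var.update h hM.FV_eq_empty)
    (ClosedSubst.var.update h hN.FV_eq_empty) (fun a ha => ⟨hG ha, rfl⟩) fun x σ hx => by
      change lookupVar ([] ++ [(h, τ)]) x = some σ at hx
      rw [lookupVar_append_singleton] at hx
      by_cases hxh : x = h
      · subst hxh
        simp only [if_true, Option.some.injEq] at hx
        subst hx
        simp only [Function.update_self]
        exact ⟨⟨hM.FV_eq_empty, hN.FV_eq_empty⟩, fun w hw =>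
          CmpRealizes.cmpRel hτ (hdM _ hw.1) (hdN _ hw.2.1)⟩
      · rw [if_neg hxh] at hx
        cases hx
  rw [← subst_eq_psubst, ← subst_eq_psubst] at key
  obtain ⟨⟨t, U, hU⟩, ⟨t', U', hU'⟩, H⟩ := key
  constructor
  · rintro ⟨G', hb⟩
    obtain ⟨w, -, -, -, b', hb₁, hb₂⟩ := H _ _ _ _ hb hU'
    rw [boolVal_injective hb₁, ← hb₂]
    exact ⟨t', hU'⟩
  · rintro ⟨G', hb⟩
    obtain ⟨w, -, -, -, b', hb₁, hb₂⟩ := H _ _ _ _ hU hb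
    rw [boolVal_injective hb₂, ← hb₁]
    exact ⟨t, hU⟩


/-- Decidable equality of functions at Nm-free types: there is a
definable (name- and gensym-free) program `E` with two holes `x, y` such that for
all closed terms `M, N` of type `α₁ → α₂`, `E[M,N]` evaluates to true iff `M` and
`N` are contextually equivalent. -/
theorem eq_program_for_nmfree_function_types :
    ∀ (α₁ α₂ : Ty), NmFreeTy α₁ → NmFreeTy α₂ →
      ∃ (E : Tm) (x y : ℕ), x ≠ y ∧ AN E = ∅ ∧ NoGensym E ∧
        Typed [(x, Ty.arrow α₁ α₂), (y, Ty.arrow α₁ α₂)] E Ty.bool ∧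
        ∀ M N : Tm, Typed [] M (Ty.arrow α₁ α₂) → Typed [] N (Ty.arrow α₁ α₂) →
          ((∃ G', Eval (AN M ∪ AN N) (subst y N (subst x M E)) G' Tm.tt) ↔
            CtxEquiv (AN M ∪ AN N) (Ty.arrow α₁ α₂) M N) := by
  classical
  intro α₁ α₂ h₁ h₂
  have hτ : NmFreeTy (.arrow α₁ α₂) := ⟨h₁, h₂⟩
  obtain ⟨Q, tQ, nQ, gQ, hQ⟩ := (definable_of_nmFree hτ).1
  refine ⟨.app (.app Q (.var 0)) (.var 1), 0, 1, zero_ne_one, by simp [AN, nQ],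
    ⟨⟨gQ, trivial⟩, trivial⟩, .app (.app (tQ.weaken _) (.var rfl)) (.var rfl), ?_⟩
  intro M N hM hN
  have eM (V : Tm) : subst 1 V M = M := subst_of_closed hM.FV_eq_empty
  have eQ (x : ℕ) (V : Tm) : subst x V Q = Q := subst_of_closed tQ.FV_eq_empty
  simp only [subst, eQ, eM, if_true, one_ne_zero, if_false]
  obtain ⟨d, hd⟩ := hM.exists_cmpRealizes hτ (G := AN M ∪ AN N) Finset.subset_union_left
  obtain ⟨d', hd'⟩ := hN.exists_cmpRealizes hτ (G := AN M ∪ AN N) Finset.subset_union_right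
  have run_test : ∀ {K : Tm} {f : Den (.arrow α₁ α₂)},
      (∀ s, AN M ∪ AN N ⊆ s → CmpRealizes _ s (run K) f) →
      CmpRealizes .bool (AN M ∪ AN N) (run (.app (.app Q M) K)) (decide (d = f)) := fun hK =>
    cmpRealizes_app (cmpRealizes_app (hQ _) hd) hK
  constructor
  · rintro ⟨G', h⟩
    have htt : Tm.tt = boolVal (decide (d = d')) := ((run_test hd').2 _ _ h).2
    have hdd : d = d' := of_decide_eq_true (boolVal_injective htt.symm)
    exact ctxEquiv_of_cmpRealizes hτ hM hN hd (hdd ▸ hd')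
  · intro h
    obtain ⟨⟨t, U, hU⟩, H⟩ := run_test hd
    have hUt : U = boolVal (decide (d = d)) := (H _ _ hU).2
    rw [decide_eq_true rfl] at hUt
    subst hUt
    have := (h 1 (.app (.app Q M) (.var 1)) true
      (.app (.app (tQ.weaken _) (hM.weaken _)) (.var rfl)) (by simp [AN, nQ])).1
    simp only [subst, eQ, eM, if_true] at this
    exact this ⟨t, hU⟩
end
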